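/- arXiv:1507.05315 — 10 statements merged into one kernel-verified Lean document; each statement's English description precedes it below -/
import Mathlib

section
/- Suppose the set M ⊆ ℝ^p is Borel measurable, non-random, and satisfies Condition A with matrix C_n = X'X/n. Then the infimum over all β ∈ ℝ^p of the probability that û_n = √n(β̂_L − β) lies in M equals the minimum over all sign vectors d ∈ {−1,1}^p of the probability that û_n^d lies in M, where û_n^d = C_n^{−1}(W_n − n^{−1/2}Λ d) has the multivariate normal distribution N(−n^{−1/2} C_n^{−1} Λ d, σ² C_n^{−1}). -/
open MeasureTheory ProbabilityTheory Filter Matrix Set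
open scoped ENNReal NNReal BigOperators

noncomputable section

/-- The set `A^d_C̄(m) = {z : ∀ j, d j * (C̄ m)_j ≤ d j * (C̄ z)_j and d j * z j ≤ 0}`. -/
def Aset {p : ℕ} (Cb : Matrix (Fin p) (Fin p) ℝ) (d m : Fin p → ℝ) : Set (Fin p → ℝ) :=
  {z | ∀ j, d j * Cb.mulVec m j ≤ d j * Cb.mulVec z j ∧ d j * z j ≤ 0}

/-- A vector with entries in `{-1, 1}`. -/
def IsSignVec {p : ℕ} (d : Fin p → ℝ) : Prop := ∀ j, d j = 1 ∨ d j = -1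

/-- Condition A with matrix `C̄`: `A^d_C̄(m) ⊆ M` for all sign vectors `d` and all `m ∈ M`. -/
def CondA {p : ℕ} (Cb : Matrix (Fin p) (Fin p) ℝ) (M : Set (Fin p → ℝ)) : Prop :=
  ∀ d : Fin p → ℝ, IsSignVec d → ∀ m ∈ M, Aset Cb d m ⊆ M

/-- `μ` is the multivariate normal distribution on `ℝ^p` with mean `m` and
covariance matrix `S`, characterized via its one-dimensional projections. -/
def IsMvGaussian {p : ℕ} (μ : Measure (Fin p → ℝ)) (m : Fin p → ℝ)
    (S : Matrix (Fin p) (Fin p) ℝ) : Prop :=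
  ∀ l : Fin p → ℝ,
    Measure.map (fun x => ∑ j, l j * x j) μ =
      gaussianReal (∑ j, l j * m j) (Real.toNNReal (l ⬝ᵥ S.mulVec l))

/-- The Lasso objective `‖y − Xb‖² + 2 Σ_j λ_j |b_j|`. -/
def lassoObjective {n p : ℕ} (y : Fin n → ℝ) (X : Matrix (Fin n) (Fin p) ℝ)
    (lam : Fin p → ℝ) (b : Fin p → ℝ) : ℝ :=
  (∑ i, (y i - X.mulVec b i) ^ 2) + 2 * ∑ j, lam j * |b j|

/-- First-order conditions at the minimum for a quadratic plus a weighted absolute value. -/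
lemma abs_penalty_first_order {g q l b : ℝ} (hq : 0 ≤ q) (hl : 0 ≤ l)
    (h : ∀ t : ℝ, 0 ≤ -2 * t * g + t ^ 2 * q + 2 * (l * (|b + t| - |b|))) :
    |g| ≤ l ∧ (0 < b → g = l) ∧ (b < 0 → g = -l) := by
  have key : ∀ t : ℝ, 2 * t * g ≤ t ^ 2 * q + 2 * (l * |t|) := by
    intro t
    have h1 : |b + t| - |b| ≤ |t| := by linarith [abs_add_le b t]
    have h2 := mul_le_mul_of_nonneg_left h1 hl
    linarith [h t]
  have bound_of_small {c r : ℝ} (hr : 0 < r) (hc : ∀ t, 0 < t → t ≤ r → 2 * c ≤ t * q) :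
      c ≤ 0 := by
    by_contra! hc0
    have hq1 : 0 < q + 1 := by linarith
    have ht : 0 < min r (c / (q + 1)) := lt_min hr (div_pos hc0 hq1)
    have h1 := hc _ ht (min_le_left _ _)
    have h2 : min r (c / (q + 1)) * q ≤ c / (q + 1) * q :=
      mul_le_mul_of_nonneg_right (min_le_right _ _) hq
    have h3 : c / (q + 1) * (q + 1) = c := div_mul_cancel₀ _ hq1.ne'
    have h4 := div_pos hc0 hq1
    nlinarith
  have hup : g ≤ l := by
    have := bound_of_small (c := g - l) one_pos fun t ht _ => by
      have := key t
      rw [abs_of_pos ht] at this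
      nlinarith
    linarith
  have hlow : -l ≤ g := by
    have := bound_of_small (c := -g - l) one_pos fun t ht _ => by
      have := key (-t)
      rw [abs_neg, abs_of_pos ht] at this
      nlinarith
    linarith
  refine ⟨abs_le.2 ⟨hlow, hup⟩, fun hb => le_antisymm hup ?_, fun hb => le_antisymm ?_ hlow⟩
  · have := bound_of_small (c := l - g) hb fun t ht htb => by
      have := h (-t)
      rw [abs_of_pos hb, abs_of_nonneg (by linarith)] at this
      nlinarith
    linarith
  · have := bound_of_small (c := l + g) (neg_pos.2 hb) fun t ht htb => by
      have := h t
      rw [abs_of_neg hb, abs_of_nonpos (by linarith)] at this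
      nlinarith
    linarith

/-- Change of the Lasso objective along a coordinate direction. -/
lemma lassoObjective_add_single {n p : ℕ} (y : Fin n → ℝ) (X : Matrix (Fin n) (Fin p) ℝ)
    (lam b : Fin p → ℝ) (j : Fin p) (t : ℝ) :
    lassoObjective y X lam (b + Pi.single j t) = lassoObjective y X lam b +
      (-2 * t * Xᵀ.mulVec (y - X.mulVec b) j + t ^ 2 * (∑ i, X i j ^ 2) +
        2 * (lam j * (|b j + t| - |b j|))) := by
  have h1 : ∑ k, lam k * |(b + Pi.single j t : Fin p → ℝ) k| =
      (∑ k, lam k * |b k|) + lam j * (|b j + t| - |b j|) := by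
    rw [← sub_eq_iff_eq_add', ← Finset.sum_sub_distrib, Finset.sum_eq_single j]
    · simp [mul_sub]
    · intro k _ hk
      simp [Pi.single_eq_of_ne hk]
    · simp
  have h2 : ∑ i, (y i - X.mulVec (b + Pi.single j t) i) ^ 2 =
      (∑ i, (y i - X.mulVec b i) ^ 2) +
        (-2 * t * Xᵀ.mulVec (y - X.mulVec b) j + t ^ 2 * (∑ i, X i j ^ 2)) := by
    simp only [Matrix.mulVec_add, Pi.add_apply, Matrix.mulVec_single, Pi.smul_apply,
      MulOpposite.smul_eq_mul_unop, MulOpposite.unop_op, Matrix.col_apply]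
    rw [show Xᵀ.mulVec (y - X.mulVec b) j = ∑ i, X i j * (y i - X.mulVec b i) from rfl,
      Finset.mul_sum, Finset.mul_sum, ← Finset.sum_add_distrib, ← Finset.sum_add_distrib]
    refine Finset.sum_congr rfl fun i _ => ?_
    ring
  simp only [lassoObjective, h1, h2]
  ring

/-- The Karush-Kuhn-Tucker conditions for a Lasso minimizer. -/
lemma lasso_kkt {n p : ℕ} {y : Fin n → ℝ} {X : Matrix (Fin n) (Fin p) ℝ} {lam b : Fin p → ℝ}
    (hlam : ∀ j, 0 ≤ lam j)
    (hb : ∀ b', lassoObjective y X lam b ≤ lassoObjective y X lam b') (j : Fin p) :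
    |Xᵀ.mulVec (y - X.mulVec b) j| ≤ lam j ∧
      (0 < b j → Xᵀ.mulVec (y - X.mulVec b) j = lam j) ∧
      (b j < 0 → Xᵀ.mulVec (y - X.mulVec b) j = -lam j) := by
  refine abs_penalty_first_order (q := ∑ i, X i j ^ 2) (by positivity) (hlam j) fun t => ?_
  have := hb (b + Pi.single j t)
  rw [lassoObjective_add_single] at this
  linarith

/-- The Gram matrix of a matrix of full column rank, scaled by a nonzero factor, is invertible. -/
lemma isUnit_det_smul_gram {n p : ℕ} {X : Matrix (Fin n) (Fin p) ℝ} (hX : X.rank = p) {c : ℝ}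
    (hc : c ≠ 0) : IsUnit (c • (Xᵀ * X)).det := by
  have hinj : Function.Injective (Xᵀ * X).mulVec := by
    have hr : (Xᵀ * X).rank = p := by rw [Matrix.rank_transpose_mul_self, hX]
    have h := (Xᵀ * X).mulVecLin.finrank_range_add_finrank_ker
    rw [← Matrix.rank, hr, Module.finrank_fin_fun, Nat.add_eq_left,
      Submodule.finrank_eq_zero] at h
    exact LinearMap.ker_eq_bot.1 h
  rw [Matrix.det_smul]
  exact (IsUnit.mk0 _ (pow_ne_zero _ hc)).mul
    ((Matrix.isUnit_iff_isUnit_det _).1 (Matrix.mulVec_injective_iff_isUnit.1 hinj))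

/-- A linear combination of i.i.d. centered Gaussian coordinates is Gaussian. -/
lemma map_linearCombination_pi_gaussianReal {n : ℕ} (v : ℝ≥0) (a : Fin n → ℝ) :
    Measure.map (fun x : Fin n → ℝ => ∑ i, a i * x i) (Measure.pi fun _ => gaussianReal 0 v) =
      gaussianReal 0 (Real.toNNReal ((v : ℝ) * ∑ i, a i ^ 2)) := by
  have hX (i : Fin n) : Measure.map (fun x : Fin n → ℝ => a i * x i)
      (Measure.pi fun _ => gaussianReal 0 v) = gaussianReal 0 (NNReal.mk (a i ^ 2) (sq_nonneg _) * v) := by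
    have h := gaussianReal_map_const_mul (μ := 0) (v := v) (a i)
    rw [mul_zero] at h
    rw [← h]
    nth_rw 2 [← (measurePreserving_eval (fun _ : Fin n => gaussianReal 0 v) i).map_eq]
    rw [Measure.map_map (by fun_prop) (by fun_prop)]
    rfl
  have hgauss (i : Fin n) : HasGaussianLaw (fun x : Fin n → ℝ => a i * x i)
      (Measure.pi fun _ => gaussianReal 0 v) := ⟨by rw [hX i]; infer_instance⟩
  have hind : iIndepFun (fun (i : Fin n) (x : Fin n → ℝ) => a i * x i)
      (Measure.pi fun _ => gaussianReal 0 v) :=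
    iIndepFun_pi (μ := fun _ : Fin n => gaussianReal 0 v) (X := fun i t => a i * t)
      fun i => by fun_prop
  have hmean (i : Fin n) : ∫ x : Fin n → ℝ, a i * x i ∂(Measure.pi fun _ => gaussianReal 0 v)
      = 0 := by
    have h := integral_map (μ := Measure.pi fun _ => gaussianReal 0 v)
      (φ := fun x : Fin n → ℝ => a i * x i)
      (Measurable.aemeasurable (by fun_prop)) (f := id) (by fun_prop)
    rw [hX i] at h
    simpa using h.symm
  have hvar (i : Fin n) : Var[fun x : Fin n → ℝ => a i * x i;
      Measure.pi fun _ => gaussianReal 0 v] = a i ^ 2 * v := by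
    have h := variance_map (μ := Measure.pi fun _ => gaussianReal 0 v)
      (Y := fun x : Fin n → ℝ => a i * x i) (X := id) (by fun_prop)
      (Measurable.aemeasurable (by fun_prop))
    rw [hX i, variance_id_gaussianReal] at h
    simpa using h.symm
  rw [(iIndepFun.hasGaussianLaw_fun_sum hgauss hind).map_eq_gaussianReal,
    integral_finsetSum _ fun i _ => (hgauss i).integrable]
  have hsum := IndepFun.variance_sum (s := Finset.univ) (fun i _ => (hgauss i).memLp_two)
    (fun i _ j _ hij => hind.indepFun hij)
  rw [Finset.sum_fn] at hsum
  rw [hsum]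
  simp [hmean, hvar, ← Finset.sum_mul, mul_comm (v : ℝ)]

/-- The scaled estimation error solves the stationarity equation of the Lasso. -/
lemma scaled_error_eq {n p : ℕ} (hn : 0 < n) {X : Matrix (Fin n) (Fin p) ℝ} (hX : X.rank = p)
    (e : Fin n → ℝ) (β b : Fin p → ℝ) :
    (fun j => Real.sqrt n * (b j - β j)) = ((n : ℝ)⁻¹ • (Xᵀ * X))⁻¹.mulVec
      ((Real.sqrt n)⁻¹ • Xᵀ.mulVec e -
        (Real.sqrt n)⁻¹ • Xᵀ.mulVec (X.mulVec β + e - X.mulVec b)) := by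
  have hn' : (0 : ℝ) < n := Nat.cast_pos.2 hn
  have hu := isUnit_det_smul_gram hX (inv_ne_zero hn'.ne')
  have hs : (n : ℝ)⁻¹ * Real.sqrt n = (Real.sqrt n)⁻¹ := by
    rw [← Real.sqrt_inv, inv_mul_eq_div, Real.sqrt_div_self', Real.sqrt_inv, one_div]
  have h : (Real.sqrt n)⁻¹ • Xᵀ.mulVec e -
      (Real.sqrt n)⁻¹ • Xᵀ.mulVec (X.mulVec β + e - X.mulVec b) =
      ((n : ℝ)⁻¹ • (Xᵀ * X)).mulVec (Real.sqrt n • (b - β)) := by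
    rw [Matrix.mulVec_smul, Matrix.smul_mulVec, smul_smul, mul_comm, hs,
      ← Matrix.mulVec_mulVec, ← smul_sub, ← Matrix.mulVec_sub, Matrix.mulVec_sub X]
    congr 2
    abel
  rw [h, Matrix.mulVec_mulVec, Matrix.nonsing_inv_mul _ hu, Matrix.one_mulVec]
  rfl

/-- Pushing a standard linear-model noise vector through an affine estimator
`C⁻¹ (X'ε/√n - c)` gives a normal law with covariance `σ² C⁻¹`. -/
lemma isMvGaussian_map_affine {Ω : Type*} [MeasurableSpace Ω] {P : Measure Ω} {n p : ℕ}
    (hn : 0 < n) {X : Matrix (Fin n) (Fin p) ℝ} (hX : X.rank = p) {σ2 : ℝ≥0}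
    {ε : Ω → Fin n → ℝ} (hεmeas : Measurable ε)
    (hεdist : Measure.map ε P = Measure.pi fun _ : Fin n => gaussianReal 0 σ2)
    (c : Fin p → ℝ) :
    IsMvGaussian
      (Measure.map (fun ω => ((n : ℝ)⁻¹ • (Xᵀ * X))⁻¹.mulVec
        ((Real.sqrt n)⁻¹ • Xᵀ.mulVec (ε ω) - c)) P)
      (-((n : ℝ)⁻¹ • (Xᵀ * X))⁻¹.mulVec c) ((σ2 : ℝ) • ((n : ℝ)⁻¹ • (Xᵀ * X))⁻¹) := by
  intro l
  have hn' : (0 : ℝ) < n := Nat.cast_pos.2 hn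
  have hu := isUnit_det_smul_gram hX (inv_ne_zero hn'.ne')
  set C := (n : ℝ)⁻¹ • (Xᵀ * X) with hC
  set w := l ᵥ* C⁻¹ with hw
  set a := (Real.sqrt n)⁻¹ • X.mulVec w with ha
  have hlin (x : Fin n → ℝ) : ∑ j, l j * C⁻¹.mulVec ((Real.sqrt n)⁻¹ • Xᵀ.mulVec x - c) j =
      ∑ j, l j * (-C⁻¹.mulVec c) j + ∑ i, a i * x i := by
    change l ⬝ᵥ C⁻¹.mulVec _ = l ⬝ᵥ (-C⁻¹.mulVec c) + a ⬝ᵥ x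
    rw [Matrix.mulVec_sub, dotProduct_sub, dotProduct_neg, Matrix.mulVec_smul, dotProduct_smul,
      dotProduct_mulVec, ← hw, dotProduct_mulVec, Matrix.vecMul_transpose, ha, smul_dotProduct]
    ring
  have hvar : ∑ i, a i ^ 2 = l ⬝ᵥ C⁻¹.mulVec l := by
    have h1 : ∑ i, a i ^ 2 = a ⬝ᵥ a := by simp [dotProduct, sq]
    have hs : (Real.sqrt n)⁻¹ * (Real.sqrt n)⁻¹ = (n : ℝ)⁻¹ := by
      rw [← mul_inv, Real.mul_self_sqrt hn'.le]
    have h2 : a ⬝ᵥ a = w ⬝ᵥ C.mulVec w := by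
      rw [ha, smul_dotProduct, dotProduct_smul, smul_smul, hs, hC, Matrix.smul_mulVec,
        dotProduct_smul, ← Matrix.mulVec_mulVec, dotProduct_mulVec w, Matrix.vecMul_transpose]
    rw [h1, h2, dotProduct_mulVec, hw, Matrix.vecMul_vecMul, Matrix.nonsing_inv_mul _ hu,
      Matrix.vecMul_one, dotProduct_mulVec l, dotProduct_comm]
  have hmeas : Measurable fun x : Fin n → ℝ =>
      C⁻¹.mulVec ((Real.sqrt n)⁻¹ • Xᵀ.mulVec x - c) :=
    (by fun_prop : Continuous _).measurable
  have hcomp : (fun ω => C⁻¹.mulVec ((Real.sqrt n)⁻¹ • Xᵀ.mulVec (ε ω) - c)) =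
      (fun x => C⁻¹.mulVec ((Real.sqrt n)⁻¹ • Xᵀ.mulVec x - c)) ∘ ε := rfl
  rw [hcomp, ← Measure.map_map hmeas hεmeas, hεdist, Measure.map_map (by fun_prop) hmeas]
  have hfun : (fun x : Fin p → ℝ => ∑ j, l j * x j) ∘
      (fun x => C⁻¹.mulVec ((Real.sqrt n)⁻¹ • Xᵀ.mulVec x - c)) =
      (fun t => ∑ j, l j * (-C⁻¹.mulVec c) j + t) ∘ fun x => ∑ i, a i * x i :=
    funext hlin
  rw [hfun, ← Measure.map_map (by fun_prop) (by fun_prop),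
    map_linearCombination_pi_gaussianReal, gaussianReal_map_const_add, zero_add, hvar,
    Matrix.smul_mulVec, dotProduct_smul, smul_eq_mul]

/-- Under Condition A, replacing the subgradient at the Lasso solution by the sign vector of the
true parameter can only move the scaled error out of `M`. -/
lemma CondA.scaled_error_mem {n p : ℕ} (hn : 0 < n) {X : Matrix (Fin n) (Fin p) ℝ}
    (hX : X.rank = p) {lam : Fin p → ℝ} (hlam : ∀ j, 0 ≤ lam j) {M : Set (Fin p → ℝ)}
    (hMA : CondA ((n : ℝ)⁻¹ • (Xᵀ * X)) M) {e : Fin n → ℝ} {β b d : Fin p → ℝ}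
    (hb : ∀ b', lassoObjective (X.mulVec β + e) X lam b ≤ lassoObjective (X.mulVec β + e) X lam b')
    (hd : ∀ j, d j = 1 ∧ 0 ≤ β j ∨ d j = -1 ∧ β j < 0)
    (hmem : ((n : ℝ)⁻¹ • (Xᵀ * X))⁻¹.mulVec
      ((Real.sqrt n)⁻¹ • Xᵀ.mulVec e - (Real.sqrt n)⁻¹ • (Matrix.diagonal lam).mulVec d) ∈ M) :
    (fun j => Real.sqrt n * (b j - β j)) ∈ M := by
  have hn' : (0 : ℝ) < n := Nat.cast_pos.2 hn
  have hs : 0 < (Real.sqrt n)⁻¹ := inv_pos.2 (Real.sqrt_pos.2 hn')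
  have hu := isUnit_det_smul_gram hX (inv_ne_zero hn'.ne')
  have hkkt := lasso_kkt hlam hb
  have herr := scaled_error_eq hn hX e β b
  set g := Xᵀ.mulVec (X.mulVec β + e - X.mulVec b)
  obtain ⟨f, hf⟩ : ∃ f : Fin p → ℝ, ∀ j, (f j = 1 ∨ f j = -1) ∧ f j * (g j - lam j * d j) ≤ 0 ∧
      f j * (b j - β j) ≤ 0 := by
    suffices h : ∀ j, ∃ s : ℝ, (s = 1 ∨ s = -1) ∧ s * (g j - lam j * d j) ≤ 0 ∧
        s * (b j - β j) ≤ 0 from Classical.skolem.1 h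
    intro j
    obtain ⟨h1, h2, h3⟩ := hkkt j
    rw [abs_le] at h1
    by_cases hg : g j = lam j * d j
    · rcases le_total (b j - β j) 0 with h | h
      · exact ⟨1, Or.inl rfl, by simp [hg], by linarith⟩
      · exact ⟨-1, Or.inr rfl, by simp [hg], by linarith⟩
    · rcases hd j with ⟨hd, hβ⟩ | ⟨hd, hβ⟩ <;> rw [hd] at hg ⊢
      · have : ¬ 0 < b j := fun h => hg (by rw [h2 h, mul_one])
        exact ⟨1, Or.inl rfl, by linarith, by linarith⟩
      · have : ¬ b j < 0 := fun h => hg (by rw [h3 h, mul_neg_one])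
        exact ⟨-1, Or.inr rfl, by linarith, by linarith⟩
  refine hMA f (fun j => (hf j).1) _ hmem fun j => ⟨?_, ?_⟩
  · rw [herr, Matrix.mulVec_mulVec, Matrix.mulVec_mulVec, Matrix.mul_nonsing_inv _ hu,
      Matrix.one_mulVec, Matrix.one_mulVec]
    simp only [Pi.sub_apply, Pi.smul_apply, smul_eq_mul, Matrix.mulVec_diagonal]
    nlinarith [mul_nonpos_of_nonneg_of_nonpos hs.le (hf j).2.1]
  · have := mul_nonpos_of_nonneg_of_nonpos (Real.sqrt_nonneg n) (hf j).2.2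
    change f j * (Real.sqrt n * (b j - β j)) ≤ 0
    linarith

/-- Along the ray through a sign vector, the scaled error eventually agrees with the affine
estimator belonging to that sign vector. -/
lemma eventually_scaled_error_eq {n p : ℕ} (hn : 0 < n) {X : Matrix (Fin n) (Fin p) ℝ}
    (hX : X.rank = p) {lam : Fin p → ℝ} (hlam : ∀ j, 0 ≤ lam j) {e : Fin n → ℝ}
    {d : Fin p → ℝ} (hd : IsSignVec d) {b : ℕ → Fin p → ℝ}
    (hb : ∀ (k : ℕ) b', lassoObjective (X.mulVec ((k : ℝ) • d) + e) X lam (b k) ≤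
      lassoObjective (X.mulVec ((k : ℝ) • d) + e) X lam b') :
    ∀ᶠ k : ℕ in atTop, (fun j => Real.sqrt n * (b k j - ((k : ℝ) • d) j)) =
      ((n : ℝ)⁻¹ • (Xᵀ * X))⁻¹.mulVec
        ((Real.sqrt n)⁻¹ • Xᵀ.mulVec e - (Real.sqrt n)⁻¹ • (Matrix.diagonal lam).mulVec d) := by
  have hn' : (0 : ℝ) < n := Nat.cast_pos.2 hn
  have hs0 : 0 < Real.sqrt n := Real.sqrt_pos.2 hn'
  set A := ((n : ℝ)⁻¹ • (Xᵀ * X))⁻¹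
  have hK (j : Fin p) : ∀ᶠ k : ℕ in atTop,
      ∑ i, |A j i| * ((Real.sqrt n)⁻¹ * |Xᵀ.mulVec e i| + (Real.sqrt n)⁻¹ * lam i) <
        Real.sqrt n * (k : ℝ) :=
    (tendsto_natCast_atTop_atTop.const_mul_atTop hs0).eventually_gt_atTop _
  filter_upwards [eventually_all.2 hK] with k hk
  have hkkt := lasso_kkt hlam (hb k)
  have herr := scaled_error_eq hn hX e ((k : ℝ) • d) (b k)
  set g := Xᵀ.mulVec (X.mulVec ((k : ℝ) • d) + e - X.mulVec (b k))
  have hbound (j : Fin p) : |Real.sqrt n * (b k j - k * d j)| < Real.sqrt n * k := by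
    refine lt_of_le_of_lt ?_ (hk j)
    rw [show Real.sqrt n * (b k j - k * d j) = _ from congrFun herr j]
    simp only [Matrix.mulVec, dotProduct]
    refine (Finset.abs_sum_le_sum_abs _ _).trans (Finset.sum_le_sum fun i _ => ?_)
    simp only [abs_mul, Pi.sub_apply, Pi.smul_apply, smul_eq_mul]
    refine mul_le_mul_of_nonneg_left ((abs_sub _ _).trans ?_) (abs_nonneg _)
    rw [abs_mul, abs_mul, abs_of_pos (inv_pos.2 hs0)]
    exact add_le_add_right (mul_le_mul_of_nonneg_left (hkkt i).1 (inv_pos.2 hs0).le) _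
  have hg : g = (Matrix.diagonal lam).mulVec d := by
    funext j
    have h := hbound j
    rw [abs_mul, abs_of_pos hs0, mul_lt_mul_iff_right₀ hs0, abs_lt] at h
    rw [Matrix.mulVec_diagonal]
    rcases hd j with hd | hd <;> rw [hd] at h ⊢
    · rw [(hkkt j).2.1 (by linarith), mul_one]
    · rw [(hkkt j).2.2 (by linarith), mul_neg_one]
  rw [herr, hg]

/-- **Minimal coverage probability of the Lasso estimator (finite samples).**
In the Gaussian linear model `y = Xβ + ε`, if `M` is Borel measurable, non-random and
satisfies Condition A with `C_n = X'X/n`, then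
`inf_β P_β(√n(β̂_L − β) ∈ M) = min_{d ∈ {−1,1}^p} P(û_n^d ∈ M)`, where
`û_n^d = C_n⁻¹(W_n − n^{−1/2}Λd)` is distributed `N(−n^{−1/2}C_n⁻¹Λd, σ²C_n⁻¹)`. -/
theorem lasso_min_coverage_finite_sample
    {Ω : Type*} [MeasurableSpace Ω] (P : Measure Ω) [IsProbabilityMeasure P]
    (n p : ℕ) (hn : 0 < n) (hp : 0 < p) (hpn : p ≤ n)
    (X : Matrix (Fin n) (Fin p) ℝ) (hX : X.rank = p)
    (σ2 : ℝ≥0) (hσ : 0 < σ2)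
    (ε : Ω → Fin n → ℝ) (hεmeas : Measurable ε)
    (hεdist : Measure.map ε P = Measure.pi fun _ : Fin n => gaussianReal 0 σ2)
    (lam : Fin p → ℝ) (hlam : ∀ j, 0 ≤ lam j)
    -- the Lasso estimator: for each true parameter `β`, `β̂_L(β)(ω)` minimizes the
    -- Lasso objective for the data `y = Xβ + ε(ω)`
    (βL : (Fin p → ℝ) → Ω → Fin p → ℝ)
    (hβLmeas : ∀ β, Measurable (βL β))
    (hβL : ∀ β ω b, lassoObjective (X.mulVec β + ε ω) X lam (βL β ω)
      ≤ lassoObjective (X.mulVec β + ε ω) X lam b)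
    (M : Set (Fin p → ℝ)) (hM : MeasurableSet M)
    (hMA : CondA ((n : ℝ)⁻¹ • (Xᵀ * X)) M)
    -- `û_n^d = C_n⁻¹ (W_n − n^{−1/2} Λ d)` with `W_n = X'ε/√n`
    (uhatd : (Fin p → ℝ) → Ω → Fin p → ℝ)
    (huhatd : ∀ d ω, uhatd d ω = ((n : ℝ)⁻¹ • (Xᵀ * X))⁻¹.mulVec
      ((Real.sqrt n)⁻¹ • Xᵀ.mulVec (ε ω) - (Real.sqrt n)⁻¹ • (Matrix.diagonal lam).mulVec d)) :
    (⨅ β : Fin p → ℝ, P {ω | (fun j => Real.sqrt n * (βL β ω j - β j)) ∈ M}) =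
      (⨅ (d : Fin p → ℝ) (_ : IsSignVec d), P {ω | uhatd d ω ∈ M}) ∧
    ∀ d : Fin p → ℝ, IsSignVec d →
      IsMvGaussian (Measure.map (uhatd d) P)
        (-((Real.sqrt n)⁻¹ • (((n : ℝ)⁻¹ • (Xᵀ * X))⁻¹ * Matrix.diagonal lam).mulVec d))
        ((σ2 : ℝ) • ((n : ℝ)⁻¹ • (Xᵀ * X))⁻¹) := by
  refine ⟨le_antisymm (le_iInf₂ fun d hd => ?_) (le_iInf fun β => ?_), fun d _ => ?_⟩
  · have htend : Tendsto (fun k : ℕ =>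
        P {ω | (fun j => Real.sqrt n * (βL ((k : ℝ) • d) ω j - ((k : ℝ) • d) j)) ∈ M}) atTop
        (nhds (P {ω | uhatd d ω ∈ M})) := by
      refine tendsto_measure_of_tendsto_indicator_of_isFiniteMeasure atTop P (fun k => ?_)
        fun ω => ?_
      · have := hβLmeas ((k : ℝ) • d)
        exact (by fun_prop : Measurable fun ω j =>
          Real.sqrt n * (βL ((k : ℝ) • d) ω j - ((k : ℝ) • d) j)) hM
      · filter_upwards [eventually_scaled_error_eq hn hX hlam hd
          (fun k => hβL ((k : ℝ) • d) ω)] with k hk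
        rw [hk, huhatd]
    exact ge_of_tendsto' htend fun k => iInf_le _ ((k : ℝ) • d)
  · classical
    set d : Fin p → ℝ := fun j => if 0 ≤ β j then 1 else -1 with hd_def
    have hd (j : Fin p) : d j = 1 ∧ 0 ≤ β j ∨ d j = -1 ∧ β j < 0 := by
      by_cases h : 0 ≤ β j
      · exact Or.inl ⟨if_pos h, h⟩
      · exact Or.inr ⟨if_neg h, not_le.1 h⟩
    refine (iInf₂_le d fun j => (hd j).imp And.left And.left).trans (measure_mono fun ω hω => ?_)
    refine hMA.scaled_error_mem hn hX hlam (hβL β ω) hd ?_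
    rw [← huhatd]
    exact hω
  · rw [funext (huhatd d)]
    have h := isMvGaussian_map_affine hn hX hεmeas hεdist
      ((Real.sqrt n)⁻¹ • (Matrix.diagonal lam).mulVec d)
    rwa [Matrix.mulVec_smul, Matrix.mulVec_mulVec] at h
end
end

section
/- Let C be a symmetric positive definite p×p real matrix. For any k > 0, the ellipse E_C(k) = {z ∈ ℝ^p : z'Cz ≤ k} satisfies Condition A with matrix C̄ = C; that is, for every d ∈ {−1,1}^p and every m ∈ E_C(k), the set A^d_C(m) is contained in E_C(k). -/
open MeasureTheory ProbabilityTheory Filter Matrix Set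
open scoped ENNReal NNReal BigOperators

noncomputable section

/-- The `C`-ellipse `E_C(k) = {z : z'Cz ≤ k}` satisfies Condition A with matrix `C`,
for any symmetric positive definite `C` and any `k > 0`. -/
theorem ellipse_satisfies_condA {p : ℕ} (C : Matrix (Fin p) (Fin p) ℝ)
    (hC : C.PosDef) (k : ℝ) (hk : 0 < k) :
    CondA C {z : Fin p → ℝ | z ⬝ᵥ C.mulVec z ≤ k} := by
  intro d hd m hm z hz
  have hsymm : m ⬝ᵥ C *ᵥ z = z ⬝ᵥ C *ᵥ m := by
    have hT : Cᵀ = C := by simpa using hC.isHermitian.eq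
    rw [dotProduct_mulVec, ← mulVec_transpose, hT, dotProduct_comm]
  have hle : z ⬝ᵥ C *ᵥ z ≤ z ⬝ᵥ C *ᵥ m := by
    refine Finset.sum_le_sum fun j _ => ?_
    obtain ⟨h₁, h₂⟩ := hz j
    rcases hd j with h | h <;> rw [h] at h₁ h₂ <;> nlinarith
  have hnonneg : 0 ≤ (z - m) ⬝ᵥ C *ᵥ (z - m) := by
    simpa using hC.posSemidef.dotProduct_mulVec_nonneg (z - m)
  rw [mulVec_sub, sub_dotProduct, dotProduct_sub, dotProduct_sub] at hnonneg
  simp only [mem_ofPred_eq] at hm ⊢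
  linarith
end
end

section
/- Let C̄ be any p×p real matrix and m ∈ ℝ^p. Then ⋃_{d ∈ {−1,1}^p} ⋂_{j=1}^p A^{d_j}_{C̄,j}(m) = ⋃_{d ∈ {−1,1}^p} ⋂_{j=1}^p (A^{d_j}_{C̄,j}(m) ∪ B^{d_j}_{C̄,j}(m)). -/
open MeasureTheory ProbabilityTheory Filter Matrix Set
open scoped ENNReal NNReal BigOperators

noncomputable section

/-- The set `A^{d_j}_{C̄,j}(m) = {z : d_j (C̄ m)_j ≤ d_j (C̄ z)_j and d_j z_j ≤ 0}`. -/
def Asetj {p : ℕ} (Cb : Matrix (Fin p) (Fin p) ℝ) (dj : ℝ) (j : Fin p) (m : Fin p → ℝ) :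
    Set (Fin p → ℝ) :=
  {z | dj * Cb.mulVec m j ≤ dj * Cb.mulVec z j ∧ dj * z j ≤ 0}

/-- The set `B^{d_j}_{C̄,j}(m) = {z : (C̄ z)_j = (C̄ m)_j and d_j z_j > 0}`. -/
def Bsetj {p : ℕ} (Cb : Matrix (Fin p) (Fin p) ℝ) (dj : ℝ) (j : Fin p) (m : Fin p → ℝ) :
    Set (Fin p → ℝ) :=
  {z | Cb.mulVec z j = Cb.mulVec m j ∧ 0 < dj * z j}

/-- Flipping the sign turns membership in `Bsetj` into membership in `Asetj`. -/
theorem Bsetj_subset_Asetj_neg {p : ℕ} (Cb : Matrix (Fin p) (Fin p) ℝ) (dj : ℝ) (j : Fin p)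
    (m : Fin p → ℝ) : Bsetj Cb dj j m ⊆ Asetj Cb (-dj) j m := by
  rintro z ⟨h, hz⟩
  exact ⟨by rw [h], by linarith⟩

/-- `⋃_{d ∈ {-1,1}^p} ⋂_j A^{d_j}_{C̄,j}(m) =
⋃_{d ∈ {-1,1}^p} ⋂_j (A^{d_j}_{C̄,j}(m) ∪ B^{d_j}_{C̄,j}(m))`. -/
theorem union_inter_A_eq_union_inter_A_union_B {p : ℕ}
    (Cb : Matrix (Fin p) (Fin p) ℝ) (m : Fin p → ℝ) :
    (⋃ (d : Fin p → ℝ) (_ : IsSignVec d), ⋂ j, Asetj Cb (d j) j m) =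
    (⋃ (d : Fin p → ℝ) (_ : IsSignVec d), ⋂ j, (Asetj Cb (d j) j m ∪ Bsetj Cb (d j) j m)) := by
  apply Subset.antisymm
  · exact iUnion₂_mono fun d _ => iInter_mono fun j => subset_union_left
  · intro z hz
    simp only [mem_iUnion, mem_iInter] at hz ⊢
    obtain ⟨d, hd, hz⟩ := hz
    have key : ∀ j, ∃ e : ℝ, (e = 1 ∨ e = -1) ∧ z ∈ Asetj Cb e j m := fun j => by
      rcases hz j with h | h
      · exact ⟨d j, hd j, h⟩
      · refine ⟨-d j, ?_, Bsetj_subset_Asetj_neg Cb (d j) j m h⟩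
        rcases hd j with h | h <;> simp [h]
    choose e he hze using key
    exact ⟨e, he, hze⟩
end
end

section
/- Consider the sequence of linear models y^{(n)} = X_n β + ε^{(n)} where X_n ∈ ℝ^{n×p} is obtained by appending rows (X_n = (x_1',…,x_n')' with fixed x_i ∈ ℝ^p), C_n = X_n'X_n/n → C with C finite and positive definite, ε^{(n)} ~ N(0, σ² I_n) with σ² > 0, and the tuning parameters satisfy λ_{n}/√n → λ ∈ [0,∞)^p. Let β̂_L^{(n)} denote the Lasso estimator. Then for each j = 1,…,p, limsup_{n→∞} sup_{β ∈ ℝ^p} P_β(β̂^{(n)}_{L,j} = 0) < 1. -/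
open MeasureTheory ProbabilityTheory Filter Matrix Set
open scoped ENNReal NNReal BigOperators Topology

noncomputable section

/-- The design matrix `X_n` with rows `x_1, …, x_n`. -/
def designMat {p : ℕ} (x : ℕ → Fin p → ℝ) (n : ℕ) : Matrix (Fin n) (Fin p) ℝ :=
  Matrix.of fun i j => x i j

/-- First-order optimality of the Lasso, tested in the direction `v`. -/
lemma abs_residual_dotProduct_le_of_lasso_min {n p : ℕ} {y : Fin n → ℝ}
    {X : Matrix (Fin n) (Fin p) ℝ} {lam b : Fin p → ℝ} (hlam : ∀ k, 0 ≤ lam k)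
    (hb : ∀ b', lassoObjective y X lam b ≤ lassoObjective y X lam b') (v : Fin p → ℝ) :
    |(y - X *ᵥ b) ⬝ᵥ (X *ᵥ v)| ≤ ∑ k, lam k * |v k| := by
  have key (t : ℝ) : 2 * t * ((y - X *ᵥ b) ⬝ᵥ (X *ᵥ v)) ≤
      t ^ 2 * ∑ i, (X *ᵥ v) i ^ 2 + 2 * (|t| * ∑ k, lam k * |v k|) := by
    have h := hb (b + t • v)
    have hquad : ∑ i, (y i - (X *ᵥ (b + t • v)) i) ^ 2 =
        ∑ i, (y i - (X *ᵥ b) i) ^ 2 - 2 * t * ((y - X *ᵥ b) ⬝ᵥ (X *ᵥ v))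
          + t ^ 2 * ∑ i, (X *ᵥ v) i ^ 2 := by
      simp only [dotProduct, Finset.mul_sum, ← Finset.sum_sub_distrib, ← Finset.sum_add_distrib,
        mulVec_add, mulVec_smul, Pi.add_apply, Pi.sub_apply, Pi.smul_apply, smul_eq_mul]
      exact Finset.sum_congr rfl fun i _ => by ring
    have hpen : ∑ k, lam k * |(b + t • v) k| ≤
        ∑ k, lam k * |b k| + |t| * ∑ k, lam k * |v k| := by
      rw [Finset.mul_sum, ← Finset.sum_add_distrib]
      refine Finset.sum_le_sum fun k _ => ?_
      have := mul_le_mul_of_nonneg_left (abs_add_le (b k) (t * v k)) (hlam k)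
      rw [abs_mul] at this
      simp only [Pi.add_apply, Pi.smul_apply, smul_eq_mul]
      linarith
    simp only [lassoObjective] at h
    rw [hquad] at h
    linarith
  set r := (y - X *ᵥ b) ⬝ᵥ (X *ᵥ v)
  set Q := ∑ i, (X *ᵥ v) i ^ 2
  set L := ∑ k, lam k * |v k|
  have hQ : 0 ≤ Q := Finset.sum_nonneg fun i _ => sq_nonneg _
  have small (t : ℝ) (ht : 0 < t) : |r| ≤ L + t * Q / 2 := by
    have h₁ := key t
    have h₂ := key (-t)
    rw [abs_neg] at h₂
    rw [abs_of_pos ht] at h₁ h₂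
    refine abs_le.2 ⟨?_, ?_⟩ <;> refine le_of_mul_le_mul_left ?_ (mul_pos two_pos ht) <;> nlinarith
  refine le_of_forall_pos_le_add fun δ hδ => (small (δ / (Q + 1)) (by positivity)).trans ?_
  have : δ / (Q + 1) * Q ≤ δ := by
    rw [div_mul_eq_mul_div, div_le_iff₀ (by positivity)]
    nlinarith
  linarith

/-- A linear combination of independent centred Gaussians is a centred Gaussian. -/
lemma map_sum_mul_pi_gaussianReal {ι : Type*} [Fintype ι] (v w : ℝ≥0) (a : ι → ℝ)
    (hw : (w : ℝ) = (∑ i, a i ^ 2) * v) :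
    (Measure.pi fun _ : ι => gaussianReal 0 v).map (fun e => ∑ i, a i * e i) =
      gaussianReal 0 w := by
  have hcomp : (fun e : ι → ℝ => ∑ i, a i * e i) =
      (fun e => ∑ i, e i) ∘ fun (e : ι → ℝ) i => a i * e i := rfl
  rw [hcomp, ← Measure.map_map (by fun_prop) (by fun_prop),
    Measure.pi_map_pi (f := fun i z => a i * z) (fun i => by fun_prop)]
  simp_rw [gaussianReal_map_const_mul]
  refine Measure.ext_of_charFun ?_
  rw [charFun_map_sum_pi_eq_prod]
  ext t
  simp only [Finset.prod_apply, charFun_gaussianReal, ← Complex.exp_sum]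
  congr 1
  have hw' : (w : ℂ) = (∑ i, (a i : ℂ) ^ 2) * (v : ℂ) := by exact_mod_cast congrArg Complex.ofReal hw
  simp [hw', Finset.sum_mul, Finset.sum_div]

lemma gaussianReal_Ioi_pos (m : ℝ) {v : ℝ≥0} (hv : v ≠ 0) (K : ℝ) :
    0 < gaussianReal m v (Ioi K) := by
  refine pos_iff_ne_zero.2 fun h => ?_
  have := gaussianReal_absolutelyContinuous' m hv h
  simp at this

/-- A centred Gaussian with standard deviation at least `τ` exceeds `M ≥ 0` at least as often as
a standard Gaussian exceeds `M / τ`. -/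
lemma gaussianReal_Ioi_div_le {w τ : ℝ≥0} (hτ : 0 < τ) (hw : τ ^ 2 ≤ w) {M : ℝ} (hM : 0 ≤ M) :
    gaussianReal 0 1 (Ioi (M / τ)) ≤ gaussianReal 0 w (Ioi M) := by
  have hmap : gaussianReal 0 w = (gaussianReal 0 1).map (fun z => (√(w : ℝ)) * z) := by
    rw [gaussianReal_map_const_mul]
    congr 1
    · simp
    · ext
      simp
  rw [hmap, Measure.map_apply (by fun_prop) measurableSet_Ioi]
  refine measure_mono fun z hz => ?_
  have hτ' : (0 : ℝ) < τ := hτ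
  have hz' : M / τ < z := hz
  have hz0 : 0 ≤ z := (div_nonneg hM hτ'.le).trans hz'.le
  have hle : (τ : ℝ) ≤ √(w : ℝ) := Real.le_sqrt_of_sq_le (by exact_mod_cast hw)
  rw [div_lt_iff₀ hτ'] at hz'
  change M < √(w : ℝ) * z
  nlinarith

/-- A centred Gaussian with standard deviation bounded below cannot concentrate on an interval of
bounded length, uniformly in the location of the interval. -/
lemma gaussianReal_abs_add_le {w τ : ℝ≥0} (hτ : 0 < τ) (hw : τ ^ 2 ≤ w) {M : ℝ} (hM : 0 ≤ M)
    (a : ℝ) :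
    gaussianReal 0 w {z | |a + z| ≤ M} ≤ 1 - gaussianReal 0 1 (Ioi (M / τ)) := by
  have hIoi := gaussianReal_Ioi_div_le hτ hw hM
  have hIio : gaussianReal 0 w (Iio (-M)) = gaussianReal 0 w (Ioi M) := by
    conv_lhs => rw [← neg_zero, ← gaussianReal_map_neg]
    rw [Measure.map_apply (by fun_prop) measurableSet_Iio]
    congr 1
    ext z
    simp
  rcases le_total 0 a with ha | ha
  · calc gaussianReal 0 w {z | |a + z| ≤ M} ≤ gaussianReal 0 w (Ioi M)ᶜ := by
          refine measure_mono fun z hz => ?_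
          have hz' : |a + z| ≤ M := hz
          have := (abs_le.1 hz').2
          simp only [mem_compl_iff, mem_Ioi, not_lt]
          linarith
      _ = 1 - gaussianReal 0 w (Ioi M) := prob_compl_eq_one_sub measurableSet_Ioi
      _ ≤ _ := tsub_le_tsub_left hIoi 1
  · calc gaussianReal 0 w {z | |a + z| ≤ M} ≤ gaussianReal 0 w (Iio (-M))ᶜ := by
          refine measure_mono fun z hz => ?_
          have hz' : |a + z| ≤ M := hz
          have := (abs_le.1 hz').1
          simp only [mem_compl_iff, mem_Iio, not_lt]
          linarith
      _ = 1 - gaussianReal 0 w (Iio (-M)) := prob_compl_eq_one_sub measurableSet_Iio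
      _ ≤ _ := by rw [hIio]; exact tsub_le_tsub_left hIoi 1

/-- **Conservative tuning yields conservative model selection.** In the sequence of
Gaussian linear models with `C_n = X_n'X_n/n → C` positive definite and
`λ_n/√n → λ ∈ [0,∞)^p`, for each component `j`,
`limsup_n sup_β P_β(β̂_{L,j}^{(n)} = 0) < 1`. -/
theorem conservative_model_selection
    {Ω : Type*} [MeasurableSpace Ω] (P : Measure Ω) [IsProbabilityMeasure P]
    {p : ℕ} (hp : 0 < p)
    (x : ℕ → Fin p → ℝ)
    (C : Matrix (Fin p) (Fin p) ℝ) (hC : C.PosDef)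
    (hCn : Tendsto (fun n : ℕ => (n : ℝ)⁻¹ • ((designMat x n)ᵀ * designMat x n))
      atTop (𝓝 C))
    (σ2 : ℝ≥0) (hσ : 0 < σ2)
    (ε : ℕ → Ω → ℝ) (hεmeas : ∀ i, Measurable (ε i))
    (hεdist : ∀ n : ℕ, Measure.map (fun ω (i : Fin n) => ε i ω) P
      = Measure.pi fun _ : Fin n => gaussianReal 0 σ2)
    (lam : ℕ → Fin p → ℝ) (hlamnn : ∀ n j, 0 ≤ lam n j)
    (lamlim : Fin p → ℝ) (hlamlim : ∀ j, 0 ≤ lamlim j)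
    (hlamconv : Tendsto (fun n : ℕ => fun j => lam n j / Real.sqrt n) atTop (𝓝 lamlim))
    -- the Lasso estimator in the `n`-th model with true parameter `β`
    (βL : (n : ℕ) → (Fin p → ℝ) → Ω → Fin p → ℝ)
    (hβLmeas : ∀ n β, Measurable (βL n β))
    (hβL : ∀ (n : ℕ) (β : Fin p → ℝ) (ω : Ω) (b : Fin p → ℝ),
      lassoObjective ((designMat x n).mulVec β + fun i : Fin n => ε i ω)
          (designMat x n) (lam n) (βL n β ω)
        ≤ lassoObjective ((designMat x n).mulVec β + fun i : Fin n => ε i ω)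
          (designMat x n) (lam n) b)
    (j : Fin p) :
    Filter.limsup (fun n : ℕ => ⨆ β : Fin p → ℝ, P {ω | βL n β ω j = 0}) atTop < 1 := by
  set Cn : ℕ → Matrix (Fin p) (Fin p) ℝ :=
    fun n => (n : ℝ)⁻¹ • ((designMat x n)ᵀ * designMat x n) with hCn_def
  -- the direction `v n = adj (C_n) e_j` satisfies `C_n (v n) = det (C_n) e_j`
  set dir : Matrix (Fin p) (Fin p) ℝ → Fin p → ℝ := fun A k => A.adjugate k j with hdir
  have hmul (A : Matrix (Fin p) (Fin p) ℝ) : A *ᵥ dir A = A.det • Pi.single j 1 := by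
    have : dir A = A.adjugate *ᵥ Pi.single j 1 := by
      ext k
      simp [hdir]
    rw [this, mulVec_mulVec, mul_adjugate, smul_mulVec, one_mulVec]
  have hdircont : Continuous dir :=
    continuous_pi fun k => (continuous_id.matrix_adjugate).matrix_elem k j
  have hquadcont : Continuous fun A : Matrix (Fin p) (Fin p) ℝ => dir A ⬝ᵥ (A *ᵥ dir A) :=
    hdircont.dotProduct (continuous_id.matrix_mulVec hdircont)
  have hquadpos : 0 < dir C ⬝ᵥ (C *ᵥ dir C) := by
    have hne : dir C ≠ 0 := by
      intro h0
      have h1 := congrFun (hmul C) j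
      simp only [h0, mulVec_zero, Pi.zero_apply, Pi.smul_apply, Pi.single_eq_same, smul_eq_mul,
        mul_one] at h1
      exact hC.det_pos.ne h1
    simpa using hC.dotProduct_mulVec_pos hne
  set q := dir C ⬝ᵥ (C *ᵥ dir C) with hq
  have hvar : ∀ᶠ n in atTop, q / 2 < dir (Cn n) ⬝ᵥ (Cn n *ᵥ dir (Cn n)) :=
    ((hquadcont.tendsto C).comp hCn).eventually (lt_mem_nhds (half_lt_self hquadpos))
  set M : ℝ := ∑ k, lamlim k * |dir C k| + 1 with hM_def
  have hM0 : 0 ≤ M := add_nonneg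
    (Finset.sum_nonneg fun k _ => mul_nonneg (hlamlim k) (abs_nonneg _)) zero_le_one
  have hpen : ∀ᶠ n : ℕ in atTop, ∑ k, lam n k / √(n : ℝ) * |dir (Cn n) k| < M := by
    have : Tendsto (fun n : ℕ => ∑ k, lam n k / √(n : ℝ) * |dir (Cn n) k|) atTop
        (𝓝 (∑ k, lamlim k * |dir C k|)) := by
      refine tendsto_finsetSum _ fun k _ => (tendsto_pi_nhds.1 hlamconv k).mul ?_
      exact (tendsto_pi_nhds.1 ((hdircont.tendsto C).comp hCn) k).abs
    exact this.eventually (gt_mem_nhds (lt_add_one _))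
  set τ : ℝ≥0 := NNReal.sqrt (Real.toNNReal (q / 2) * σ2) with hτ_def
  have hτ : 0 < τ := NNReal.sqrt_pos.2 (mul_pos (Real.toNNReal_pos.2 (half_pos hquadpos)) hσ)
  refine lt_of_le_of_lt (b := 1 - gaussianReal 0 1 (Ioi (M / τ))) ?_
    (ENNReal.sub_lt_self ENNReal.one_ne_top one_ne_zero
      (gaussianReal_Ioi_pos 0 one_ne_zero _).ne')
  refine limsup_le_of_le (by isBoundedDefault) ?_
  filter_upwards [hvar, hpen, eventually_gt_atTop 0] with n hvarn hpenn hn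
  refine iSup_le fun β => ?_
  have hn' : (0 : ℝ) < n := Nat.cast_pos.2 hn
  have hs : 0 < √(n : ℝ) := Real.sqrt_pos.2 hn'
  have hss : √(n : ℝ) * √(n : ℝ) = n := Real.mul_self_sqrt hn'.le
  set X := designMat x n
  set v := dir (Cn n) with hv
  have hXX : Xᵀ *ᵥ (X *ᵥ v) = ((n : ℝ) * (Cn n).det) • Pi.single j 1 := by
    rw [mul_smul, ← hmul, mulVec_mulVec, hCn_def, smul_mulVec, smul_smul,
      mul_inv_cancel₀ hn'.ne', one_smul]
  set a : Fin n → ℝ := fun i => (X *ᵥ v) i / √(n : ℝ) with ha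
  have hsum : ∑ i, a i ^ 2 = v ⬝ᵥ (Cn n *ᵥ v) := by
    have h1 : v ⬝ᵥ (Cn n *ᵥ v) = (n : ℝ)⁻¹ * ((X *ᵥ v) ⬝ᵥ (X *ᵥ v)) := by
      rw [hCn_def, smul_mulVec, dotProduct_smul, ← mulVec_mulVec, dotProduct_mulVec,
        vecMul_transpose, smul_eq_mul]
    rw [h1, dotProduct, Finset.mul_sum]
    refine Finset.sum_congr rfl fun i _ => ?_
    rw [ha, div_pow, sq √(n : ℝ), hss]
    ring
  set w : ℝ≥0 := Real.toNNReal (∑ i, a i ^ 2) * σ2 with hw_def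
  have hsum0 : 0 ≤ ∑ i, a i ^ 2 := Finset.sum_nonneg fun i _ => sq_nonneg _
  have hlaw := map_sum_mul_pi_gaussianReal σ2 w a (by simp [hw_def, Real.coe_toNNReal _ hsum0])
  have hτw : τ ^ 2 ≤ w := by
    rw [hτ_def, NNReal.sq_sqrt, hw_def, hsum]
    gcongr
  rw [← hεdist n, Measure.map_map (by fun_prop) (by fun_prop)] at hlaw
  refine le_trans ?_ (gaussianReal_abs_add_le hτ hτw hM0 (√(n : ℝ) * (Cn n).det * β j))
  rw [← hlaw, Measure.map_apply (by fun_prop)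
    (measurableSet_le (by fun_prop) measurable_const)]
  refine measure_mono fun ω hω => ?_
  have hω' : βL n β ω j = 0 := hω
  have hkkt := abs_residual_dotProduct_le_of_lasso_min (hlamnn n) (hβL n β ω) v
  have hres : (X *ᵥ β + (fun i : Fin n => ε i ω) - X *ᵥ βL n β ω) ⬝ᵥ (X *ᵥ v) =
      √(n : ℝ) * (√(n : ℝ) * (Cn n).det * β j + ∑ i, a i * ε i ω) := by
    have h1 : X *ᵥ β + (fun i : Fin n => ε i ω) - X *ᵥ βL n β ω =
        X *ᵥ (β - βL n β ω) + fun i : Fin n => ε i ω := by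
      rw [mulVec_sub]
      abel
    have h2 : (X *ᵥ (β - βL n β ω)) ⬝ᵥ (X *ᵥ v) = n * (Cn n).det * β j := by
      rw [dotProduct_comm, dotProduct_mulVec, ← mulVec_transpose, hXX]
      simp [hω']
    have h3 : (fun i : Fin n => ε i ω) ⬝ᵥ (X *ᵥ v) = √(n : ℝ) * ∑ i, a i * ε i ω := by
      rw [dotProduct, Finset.mul_sum]
      refine Finset.sum_congr rfl fun i _ => ?_
      simp only [ha]
      field_simp
    rw [h1, add_dotProduct, h2, h3]
    linear_combination -((Cn n).det * β j) * hss
  rw [hres, abs_mul, abs_of_pos hs] at hkkt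
  change |√(n : ℝ) * (Cn n).det * β j + ∑ i, a i * ε i ω| ≤ M
  refine le_of_mul_le_mul_left (hkkt.trans ?_) hs
  refine le_trans (le_of_eq ?_) (mul_le_mul_of_nonneg_left hpenn.le hs.le)
  rw [Finset.mul_sum]
  refine Finset.sum_congr rfl fun k _ => ?_
  field_simp
end
end

section
/- Let C be a symmetric positive definite p×p matrix, λ ∈ [0,∞)^p with Λ = diag(λ), σ² > 0, and W ~ N(0, σ² C). For t ∈ [−∞,∞]^p let û(t) be the unique minimizer over u ∈ ℝ^p of Q_t(u) = u'Cu − 2W'u + 2 Σ_{j=1}^p λ_j [ 1{t_j ∈ ℝ}(|t_j + u_j| − |t_j|) + 1{|t_j| = ∞} sgn(t_j) u_j ], and for d ∈ {−1,1}^p let û^d be the unique minimizer of Q^d(u) = u'Cu − 2W'u + 2 Σ_{j=1}^p λ_j d_j u_j. If M ⊆ ℝ^p is Borel measurable and satisfies Condition A with matrix C, then inf_{t ∈ [−∞,∞]^p} P(û(t) ∈ M) = min_{d ∈ {−1,1}^p} P(û^d ∈ M), and û^d has distribution N(−C^{−1} Λ d, σ² C^{−1}). -/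
open MeasureTheory ProbabilityTheory Filter Matrix Set
open scoped ENNReal NNReal BigOperators

noncomputable section

/-- The penalty term `1{t_j ∈ ℝ}(|t_j + u_j| − |t_j|) + 1{|t_j| = ∞} sgn(t_j) u_j`,
multiplied by the tuning weight `λ_j`. -/
def penTerm (tj : EReal) (lamj uj : ℝ) : ℝ :=
  if tj = ⊤ then lamj * uj
  else if tj = ⊥ then -(lamj * uj)
  else lamj * (|tj.toReal + uj| - |tj.toReal|)

/-- `Q_t(u) = u'Cu − 2W'u + 2 Σ_j λ_j [1{t_j ∈ ℝ}(|t_j + u_j| − |t_j|)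
+ 1{|t_j| = ∞} sgn(t_j) u_j]`. -/
def Qfun {p : ℕ} (C : Matrix (Fin p) (Fin p) ℝ) (W lam : Fin p → ℝ)
    (t : Fin p → EReal) (u : Fin p → ℝ) : ℝ :=
  u ⬝ᵥ C.mulVec u - 2 * (W ⬝ᵥ u) + 2 * ∑ j, penTerm (t j) (lam j) (u j)

/-- `Q^d(u) = u'Cu − 2W'u + 2 Σ_j λ_j d_j u_j`. -/
def Qdfun {p : ℕ} (C : Matrix (Fin p) (Fin p) ℝ) (W lam : Fin p → ℝ)
    (d : Fin p → ℝ) (u : Fin p → ℝ) : ℝ :=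
  u ⬝ᵥ C.mulVec u - 2 * (W ⬝ᵥ u) + 2 * ∑ j, lam j * d j * u j

/-- A perturbation that stays nonnegative to second order has nonnegative slope. -/
lemma nonneg_of_forall_small_nonneg {a b ε : ℝ} (hε : 0 < ε)
    (h : ∀ x, 0 < x → x < ε → 0 ≤ a * x + b * x ^ 2) : 0 ≤ a := by
  by_contra! ha
  have hb : 0 < |b| + 1 := by positivity
  set x := min (ε / 2) (-a / (2 * (|b| + 1))) with hx
  have hx0 : 0 < x := lt_min (by linarith) (div_pos (by linarith) (by linarith))
  have hxε : x < ε := (min_le_left _ _).trans_lt (by linarith)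
  have hxa : x * (2 * (|b| + 1)) ≤ -a := (le_div_iff₀ (by linarith)).1 (min_le_right _ _)
  have h1 := h x hx0 hxε
  have h2 : 0 ≤ a + b * x := by
    by_contra! hneg
    nlinarith
  nlinarith [mul_le_mul_of_nonneg_right (le_abs_self b) hx0.le,
    mul_nonneg (abs_nonneg b) hx0.le]

lemma quadratic_add_single {p : ℕ} {C : Matrix (Fin p) (Fin p) ℝ} (hC : C.PosDef)
    (W u : Fin p → ℝ) (j : Fin p) (x : ℝ) :
    (u + Pi.single j x) ⬝ᵥ C.mulVec (u + Pi.single j x) - 2 * (W ⬝ᵥ (u + Pi.single j x)) =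
      u ⬝ᵥ C.mulVec u - 2 * (W ⬝ᵥ u) + 2 * (C.mulVec u j - W j) * x + C j j * x ^ 2 := by
  have hsymm : Cᵀ = C := by simpa using hC.isHermitian.eq
  have h1 : u ⬝ᵥ C.mulVec (Pi.single j x) = C.mulVec u j * x := by
    rw [dotProduct_mulVec, ← mulVec_transpose, hsymm, dotProduct_single]
  rw [mulVec_add, add_dotProduct, dotProduct_add, dotProduct_add, dotProduct_add, h1,
    single_dotProduct, single_dotProduct, dotProduct_single]
  simp [mulVec_single]
  ring

/-- First-order comparison for a minimizer of a quadratic plus a separable penalty: if moving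
coordinate `j` from `u j` in direction `s` changes the penalty at rate at most `r`, the quadratic
part decreases at rate at most `r`. -/
lemma slope_nonneg_of_isMin {p : ℕ} {C : Matrix (Fin p) (Fin p) ℝ} (hC : C.PosDef)
    {W u : Fin p → ℝ} {f : Fin p → ℝ → ℝ}
    (hmin : ∀ v, u ⬝ᵥ C.mulVec u - 2 * (W ⬝ᵥ u) + 2 * ∑ i, f i (u i) ≤
      v ⬝ᵥ C.mulVec v - 2 * (W ⬝ᵥ v) + 2 * ∑ i, f i (v i))
    {j : Fin p} {s r ε : ℝ} (hε : 0 < ε)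
    (hf : ∀ x, 0 < x → x < ε → f j (u j + s * x) - f j (u j) ≤ r * x) :
    0 ≤ s * (C.mulVec u j - W j) + r := by
  suffices 0 ≤ 2 * (s * (C.mulVec u j - W j) + r) by linarith
  refine nonneg_of_forall_small_nonneg (b := C j j * s ^ 2) hε fun x hx0 hxε => ?_
  have h := hmin (u + Pi.single j (s * x))
  rw [quadratic_add_single hC] at h
  have hsum : ∑ i, f i ((u + Pi.single j (s * x) : Fin p → ℝ) i) - ∑ i, f i (u i) =
      f j (u j + s * x) - f j (u j) := by
    rw [← Finset.sum_sub_distrib, Finset.sum_eq_single j]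
    · simp
    · intro i _ hij
      simp [Pi.single_eq_of_ne hij]
    · simp
  linarith [hf x hx0 hxε]

/-- The normal equations of the linearly penalized least squares problem. -/
lemma mulVec_eq_of_isMin_Qdfun {p : ℕ} {C : Matrix (Fin p) (Fin p) ℝ} (hC : C.PosDef)
    {W lam d u : Fin p → ℝ} (hmin : ∀ v, Qdfun C W lam d u ≤ Qdfun C W lam d v) (j : Fin p) :
    C.mulVec u j = W j - lam j * d j := by
  have key : ∀ s : ℝ, 0 ≤ s * (C.mulVec u j - W j) + s * (lam j * d j) := fun s =>
    slope_nonneg_of_isMin hC (f := fun i y => lam i * d i * y) hmin one_pos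
      (fun x _ _ => by apply le_of_eq; ring)
  linarith [key 1, key (-1)]

lemma eq_inv_mulVec_of_isMin_Qdfun {p : ℕ} {C : Matrix (Fin p) (Fin p) ℝ} (hC : C.PosDef)
    {W lam d u : Fin p → ℝ} (hmin : ∀ v, Qdfun C W lam d u ≤ Qdfun C W lam d v) :
    u = C⁻¹.mulVec (W - (diagonal lam).mulVec d) := by
  have h : C.mulVec u = W - (diagonal lam).mulVec d := by
    ext j
    simp [mulVec_eq_of_isMin_Qdfun hC hmin j, mulVec_diagonal]
  have hdet : IsUnit C.det := hC.det_pos.ne'.isUnit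
  rw [← h, mulVec_mulVec, nonsing_inv_mul _ hdet, one_mulVec]

/-- `s` is a sign of the extended real `t`, with either sign allowed at `0`. -/
def IsSignOf (t : EReal) (s : ℝ) : Prop := (s = 1 ∧ 0 ≤ t) ∨ (s = -1 ∧ t ≤ 0)

lemma penTerm_add_sub_le {t : EReal} {s l : ℝ} (hs : IsSignOf t s) (hl : 0 ≤ l) (u : ℝ)
    {x : ℝ} (hx : 0 < x) : penTerm t l (u + s * x) - penTerm t l u ≤ l * x := by
  have h1 : ∀ a : ℝ, |a + (u + s * x)| ≤ |a + u| + x := fun a => by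
    have h := abs_add_le (a + u) (s * x)
    have h2 : |s * x| = x := by rcases hs with ⟨rfl, _⟩ | ⟨rfl, _⟩ <;> simp [abs_of_pos hx]
    rw [h2] at h
    rwa [← add_assoc]
  induction t with
  | top =>
    rcases hs with ⟨rfl, _⟩ | ⟨_, h⟩
    · simp [penTerm]; linarith
    · simp at h
  | bot =>
    rcases hs with ⟨_, h⟩ | ⟨rfl, _⟩
    · simp at h
    · simp [penTerm]; linarith
  | coe a =>
    simp only [penTerm, EReal.coe_ne_top, EReal.coe_ne_bot, if_false, EReal.toReal_coe]
    nlinarith [h1 a]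

lemma penTerm_sub_sub_le {t : EReal} {s l u x : ℝ} (hs : IsSignOf t s) (hx0 : 0 < x)
    (hx : x < s * u) : penTerm t l (u + -s * x) - penTerm t l u ≤ -l * x := by
  apply le_of_eq
  induction t with
  | top =>
    rcases hs with ⟨rfl, _⟩ | ⟨_, h⟩
    · simp [penTerm]; ring
    · simp at h
  | bot =>
    rcases hs with ⟨_, h⟩ | ⟨rfl, _⟩
    · simp at h
    · simp [penTerm]; ring
  | coe a =>
    simp only [penTerm, EReal.coe_ne_top, EReal.coe_ne_bot, if_false, EReal.toReal_coe]
    have ha : 0 ≤ s * a := by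
      rcases hs with ⟨rfl, h⟩ | ⟨rfl, h⟩ <;> norm_cast at h <;> linarith
    have habs : ∀ y, 0 ≤ s * y → |y| = s * y := fun y hy => by
      rcases hs with ⟨rfl, _⟩ | ⟨rfl, _⟩
      · rw [abs_of_nonneg (by linarith)]; ring
      · rw [abs_of_nonpos (by linarith)]; ring
    have hsq : s * s = 1 := by rcases hs with ⟨rfl, _⟩ | ⟨rfl, _⟩ <;> norm_num
    rw [habs (a + (u + -s * x)) (by linear_combination ha + hx.le + x * hsq),
      habs (a + u) (by linarith)]
    linear_combination (-l * x) * hsq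

/-- The minimizer of `Q_t` lies in one of the sets `A^e` generated by the minimizer of `Q^d`,
where `d` is a sign vector of `t`. -/
lemma exists_mem_Aset_of_isMin {p : ℕ} {C : Matrix (Fin p) (Fin p) ℝ} (hC : C.PosDef)
    {W lam d z m : Fin p → ℝ} (hlam : ∀ j, 0 ≤ lam j) {t : Fin p → EReal}
    (hd : ∀ j, IsSignOf (t j) (d j))
    (hz : ∀ v, Qfun C W lam t z ≤ Qfun C W lam t v)
    (hm : ∀ v, Qdfun C W lam d m ≤ Qdfun C W lam d v) :
    ∃ e, IsSignVec e ∧ z ∈ Aset C e m := by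
  have hds : IsSignVec d := fun j => (hd j).imp And.left And.left
  have hlow : ∀ j, 0 ≤ d j * (C.mulVec z j - W j) + lam j := fun j =>
    slope_nonneg_of_isMin hC (f := fun i y => penTerm (t i) (lam i) y) hz one_pos
      fun x hx _ => penTerm_add_sub_le (hd j) (hlam j) (z j) hx
  have hupp : ∀ j, 0 < d j * z j → 0 ≤ -d j * (C.mulVec z j - W j) + -lam j := fun j hj =>
    slope_nonneg_of_isMin hC (f := fun i y => penTerm (t i) (lam i) y) hz hj
      fun x hx0 hx => penTerm_sub_sub_le (hd j) hx0 hx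
  refine ⟨fun j => if 0 < d j * z j then -d j else d j, fun j => ?_, fun j => ?_⟩
  · dsimp only
    split_ifs
    · rcases hds j with h | h <;> simp [h]
    · exact hds j
  · rw [mulVec_eq_of_isMin_Qdfun hC hm j]
    have hl := hlow j
    have hsq : d j * d j = 1 := by rcases hds j with h | h <;> simp [h]
    have hexp : d j * (W j - lam j * d j) = d j * W j - lam j := by
      linear_combination (-lam j) * hsq
    dsimp only
    split_ifs with hj
    · have hu := hupp j hj
      constructor <;> linarith
    · constructor <;> linarith

lemma Qfun_infinite {p : ℕ} (C : Matrix (Fin p) (Fin p) ℝ) (W lam : Fin p → ℝ)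
    {d : Fin p → ℝ} (hd : IsSignVec d) (u : Fin p → ℝ) :
    Qfun C W lam (fun j => if d j = 1 then ⊤ else ⊥) u = Qdfun C W lam d u := by
  unfold Qfun Qdfun
  congr 2
  refine Finset.sum_congr rfl fun j _ => ?_
  rcases hd j with h | h
  · simp [penTerm, h]
  · norm_num [penTerm, h]

/-- The affine image of a centered Gaussian vector under `w ↦ C⁻¹ (w - Λ d)`. -/
lemma isMvGaussian_inv_mulVec {Ω : Type*} [MeasurableSpace Ω] {P : Measure Ω}
    {p : ℕ} {C : Matrix (Fin p) (Fin p) ℝ} (hC : C.PosDef) {lam d : Fin p → ℝ} {σ2 : ℝ}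
    {W : Ω → Fin p → ℝ} (hWmeas : Measurable W)
    (hW : IsMvGaussian (Measure.map W P) 0 (σ2 • C)) {U : Ω → Fin p → ℝ}
    (hU : ∀ ω, U ω = C⁻¹.mulVec (W ω - (diagonal lam).mulVec d)) :
    IsMvGaussian (Measure.map U P) (-(C⁻¹ * diagonal lam).mulVec d) (σ2 • C⁻¹) := by
  intro l
  have hdet : IsUnit C.det := hC.det_pos.ne'.isUnit
  have hsymm : (C⁻¹)ᵀ = C⁻¹ := by simpa using hC.inv.isHermitian.eq
  have hmeasl : ∀ a : Fin p → ℝ, Measurable fun x : Fin p → ℝ => ∑ j, a j * x j := by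
    intro a; fun_prop
  have hmeasC : Measurable U := by
    rw [funext hU]
    have : Continuous fun x : Fin p → ℝ => C⁻¹.mulVec (x - (diagonal lam).mulVec d) := by
      fun_prop
    exact this.measurable.comp hWmeas
  have hlaw := hW (C⁻¹.mulVec l)
  rw [Measure.map_map (hmeasl _) hWmeas] at hlaw
  rw [Measure.map_map (hmeasl _) hmeasC]
  have hcomp : (fun x : Fin p → ℝ => ∑ j, l j * x j) ∘ U =
      (fun y => y + ∑ j, l j * (-(C⁻¹ * diagonal lam).mulVec d) j) ∘
        ((fun x : Fin p → ℝ => ∑ j, (C⁻¹.mulVec l) j * x j) ∘ W) := by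
    funext ω
    change l ⬝ᵥ U ω = C⁻¹.mulVec l ⬝ᵥ W ω + l ⬝ᵥ -(C⁻¹ * diagonal lam).mulVec d
    have h : C⁻¹.mulVec l ⬝ᵥ W ω = l ⬝ᵥ C⁻¹.mulVec (W ω) := by
      rw [dotProduct_mulVec, ← mulVec_transpose, hsymm]
    rw [hU, h, ← dotProduct_add, mulVec_sub, mulVec_mulVec, sub_eq_add_neg]
  rw [hcomp, ← Measure.map_map (measurable_add_const _) ((hmeasl _).comp hWmeas), hlaw,
    gaussianReal_map_add_const]
  congr 2
  · simp
  · rw [smul_mulVec, smul_mulVec, mulVec_mulVec, mul_nonsing_inv _ hdet, one_mulVec,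
      dotProduct_smul, dotProduct_smul, dotProduct_comm]

/-- **Asymptotic minimal coverage under conservative tuning.** If `M` is Borel measurable
and satisfies Condition A with matrix `C`, then
`inf_{t ∈ [−∞,∞]^p} P(û(t) ∈ M) = min_{d ∈ {−1,1}^p} P(û^d ∈ M)`, where `û(t)` minimizes
`Q_t`, `û^d` minimizes `Q^d`, and `û^d ∼ N(−C⁻¹Λd, σ²C⁻¹)`. -/
theorem asymptotic_min_coverage_conservative
    {Ω : Type*} [MeasurableSpace Ω] (P : Measure Ω) [IsProbabilityMeasure P]
    {p : ℕ} (hp : 0 < p)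
    (C : Matrix (Fin p) (Fin p) ℝ) (hC : C.PosDef)
    (lam : Fin p → ℝ) (hlam : ∀ j, 0 ≤ lam j)
    (σ2 : ℝ) (hσ : 0 < σ2)
    (W : Ω → Fin p → ℝ) (hWmeas : Measurable W)
    (hW : IsMvGaussian (Measure.map W P) 0 (σ2 • C))
    (uhat : (Fin p → EReal) → Ω → Fin p → ℝ)
    (huhatmeas : ∀ t, Measurable (uhat t))
    (huhat : ∀ t ω u, Qfun C (W ω) lam t (uhat t ω) ≤ Qfun C (W ω) lam t u)
    (uhatd : (Fin p → ℝ) → Ω → Fin p → ℝ)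
    (huhatdmeas : ∀ d, Measurable (uhatd d))
    (huhatd : ∀ d ω u, Qdfun C (W ω) lam d (uhatd d ω) ≤ Qdfun C (W ω) lam d u)
    (M : Set (Fin p → ℝ)) (hM : MeasurableSet M) (hMA : CondA C M) :
    (⨅ t : Fin p → EReal, P {ω | uhat t ω ∈ M}) =
      (⨅ (d : Fin p → ℝ) (_ : IsSignVec d), P {ω | uhatd d ω ∈ M}) ∧
    ∀ d : Fin p → ℝ, IsSignVec d →
      IsMvGaussian (Measure.map (uhatd d) P)
        (-(C⁻¹ * Matrix.diagonal lam).mulVec d) (σ2 • C⁻¹) := by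
  have hsgn : ∀ t : EReal, ∃ s : ℝ, IsSignOf t s := fun t =>
    (le_total 0 t).elim (fun h => ⟨1, Or.inl ⟨rfl, h⟩⟩) (fun h => ⟨-1, Or.inr ⟨rfl, h⟩⟩)
  refine ⟨le_antisymm (le_iInf₂ fun d hd => ?_) (le_iInf fun t => ?_), fun d _ => ?_⟩
  · refine iInf_le_of_le (fun j => if d j = 1 then ⊤ else ⊥) (le_of_eq ?_)
    congr 1
    ext ω
    have hQ := Qfun_infinite C (W ω) lam hd
    have h := huhat (fun j => if d j = 1 then ⊤ else ⊥) ω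
    simp only [hQ] at h
    simp only [mem_ofPred_eq]
    rw [eq_inv_mulVec_of_isMin_Qdfun hC h, eq_inv_mulVec_of_isMin_Qdfun hC (huhatd d ω)]
  · choose d hd using fun j => hsgn (t j)
    have hds : IsSignVec d := fun j => (hd j).imp And.left And.left
    refine iInf₂_le_of_le d hds (measure_mono fun ω hω => ?_)
    obtain ⟨e, he, hmem⟩ := exists_mem_Aset_of_isMin hC hlam hd (huhat t ω) (huhatd d ω)
    exact hMA e he _ hω hmem
  · exact isMvGaussian_inv_mulVec hC hWmeas hW
      fun ω => eq_inv_mulVec_of_isMin_Qdfun hC (huhatd d ω)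
end
end

section
/- Suppose the set M ⊆ ℝ^p is Borel measurable, non-random, and satisfies ⋂_{j=1}^p (A^{1}_{C_n,j}(m) ∪ B^{1}_{C_n,j}(m)) ⊆ M for all m ∈ M, where C_n = X'X/n. Then the infimum, over all β ∈ ℝ^p with β_j ≥ 0 for all j, of the probability that û_n = √n(β̂_L − β) lies in M equals the probability that û_n^ι = C_n^{−1}(W_n − n^{−1/2} λ) lies in M, where W_n = X'ε/√n and λ = (λ_1,…,λ_p)'. -/
open MeasureTheory ProbabilityTheory Filter Matrix Set
open scoped ENNReal NNReal BigOperators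

noncomputable section

theorem lassoObjective_add {n p : ℕ} (y : Fin n → ℝ) (X : Matrix (Fin n) (Fin p) ℝ)
    (lam b d : Fin p → ℝ) :
    lassoObjective y X lam (b + d) = lassoObjective y X lam b
      - 2 * (Xᵀ.mulVec (y - X.mulVec b) ⬝ᵥ d) + ∑ i, X.mulVec d i ^ 2
      + 2 * ∑ j, lam j * (|b j + d j| - |b j|) := by
  have h : Xᵀ.mulVec (y - X.mulVec b) ⬝ᵥ d = ∑ i, (y i - X.mulVec b i) * X.mulVec d i := by
    rw [Matrix.mulVec_transpose, ← Matrix.dotProduct_mulVec]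
    simp [dotProduct]
  rw [h]
  simp only [lassoObjective, Matrix.mulVec_add, Pi.add_apply, mul_sub, Finset.sum_sub_distrib]
  have h2 : ∑ i, (y i - (X.mulVec b i + X.mulVec d i)) ^ 2 = ∑ i, (y i - X.mulVec b i) ^ 2
      - 2 * ∑ i, (y i - X.mulVec b i) * X.mulVec d i + ∑ i, X.mulVec d i ^ 2 := by
    rw [Finset.mul_sum, ← Finset.sum_sub_distrib, ← Finset.sum_add_distrib]
    exact Finset.sum_congr rfl fun i _ => by ring
  rw [h2]
  ring

/-- First-order variation of the Lasso objective along one coordinate at a minimizer. -/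
theorem lasso_coordinate_variation {n p : ℕ} {y : Fin n → ℝ} {X : Matrix (Fin n) (Fin p) ℝ}
    {lam b : Fin p → ℝ} (hb : ∀ c, lassoObjective y X lam b ≤ lassoObjective y X lam c)
    (j : Fin p) (t : ℝ) :
    0 ≤ -2 * (t * Xᵀ.mulVec (y - X.mulVec b) j) + t ^ 2 * ∑ i, X i j ^ 2
      + 2 * (lam j * (|b j + t| - |b j|)) := by
  have h := hb (b + Pi.single j t)
  rw [lassoObjective_add] at h
  have h1 : ∑ i, X.mulVec (Pi.single j t) i ^ 2 = t ^ 2 * ∑ i, X i j ^ 2 := by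
    rw [Finset.mul_sum]
    refine Finset.sum_congr rfl fun i _ => ?_
    simp [Matrix.mulVec_single, mul_pow, mul_comm]
  have h2 : ∑ k, lam k * (|b k + (Pi.single j t : Fin p → ℝ) k| - |b k|)
      = lam j * (|b j + t| - |b j|) := by
    rw [Finset.sum_eq_single j]
    · simp
    · intro k _ hk
      simp [hk]
    · simp
  rw [h1, h2, dotProduct_single] at h
  linarith

theorem nonneg_of_forall_small_quadratic {a c δ : ℝ} (hδ : 0 < δ)
    (h : ∀ t, 0 < t → t ≤ δ → 0 ≤ t * c + t ^ 2 * a) : 0 ≤ c := by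
  by_contra! hc
  have ha : 0 < |a| + 1 := by positivity
  set t := min δ (-c / (2 * (|a| + 1))) with ht
  have hq : 0 < -c / (2 * (|a| + 1)) := div_pos (by linarith) (by positivity)
  have ht0 : 0 < t := lt_min hδ hq
  have h1 := h t ht0 (min_le_left _ _)
  have h2 : t * (2 * (|a| + 1)) ≤ -c := by
    rw [← le_div_iff₀ (by positivity)]
    exact min_le_right _ _
  have h3 : 0 ≤ c + t * a := by
    by_contra! h4
    nlinarith [mul_pos_of_neg_of_neg (neg_neg_of_pos ht0) h4]
  nlinarith [mul_le_mul_of_nonneg_left (le_abs_self a) ht0.le, abs_nonneg a]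

theorem lasso_gradient_le {n p : ℕ} {y : Fin n → ℝ} {X : Matrix (Fin n) (Fin p) ℝ}
    {lam b : Fin p → ℝ} (hlam : ∀ j, 0 ≤ lam j)
    (hb : ∀ c, lassoObjective y X lam b ≤ lassoObjective y X lam c) (j : Fin p) :
    Xᵀ.mulVec (y - X.mulVec b) j ≤ lam j := by
  have key : 0 ≤ 2 * (lam j - Xᵀ.mulVec (y - X.mulVec b) j) := by
    refine nonneg_of_forall_small_quadratic (a := ∑ i, X i j ^ 2) one_pos fun t ht _ => ?_
    have h := lasso_coordinate_variation hb j t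
    have h1 : |b j + t| - |b j| ≤ t := by
      have := abs_add_le (b j) t
      rw [abs_of_pos ht] at this
      linarith
    have h2 := mul_le_mul_of_nonneg_left h1 (hlam j)
    linarith
  linarith

theorem lasso_gradient_eq_of_pos {n p : ℕ} {y : Fin n → ℝ} {X : Matrix (Fin n) (Fin p) ℝ}
    {lam b : Fin p → ℝ} (hlam : ∀ j, 0 ≤ lam j)
    (hb : ∀ c, lassoObjective y X lam b ≤ lassoObjective y X lam c) {j : Fin p}
    (hj : 0 < b j) : Xᵀ.mulVec (y - X.mulVec b) j = lam j := by
  refine le_antisymm (lasso_gradient_le hlam hb j) ?_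
  have key : 0 ≤ 2 * (Xᵀ.mulVec (y - X.mulVec b) j - lam j) := by
    refine nonneg_of_forall_small_quadratic (a := ∑ i, X i j ^ 2) hj fun t _ ht => ?_
    have h := lasso_coordinate_variation hb j (-t)
    rw [abs_of_nonneg (by linarith : 0 ≤ b j + -t), abs_of_pos hj] at h
    linarith
  linarith

/-- A nonnegative point solving the Lasso stationarity equations with positive signs is the only
minimizer. -/
theorem lasso_eq_of_gradient_eq {n p : ℕ} {y : Fin n → ℝ} {X : Matrix (Fin n) (Fin p) ℝ}
    (hX : Function.Injective X.mulVec) {lam b b₀ : Fin p → ℝ} (hlam : ∀ j, 0 ≤ lam j)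
    (hb : ∀ c, lassoObjective y X lam b ≤ lassoObjective y X lam c)
    (hpos : ∀ j, 0 ≤ b₀ j) (hgrad : Xᵀ.mulVec (y - X.mulVec b₀) = lam) : b = b₀ := by
  have h := hb b₀
  have hadd := lassoObjective_add y X lam b₀ (b - b₀)
  rw [add_sub_cancel, hgrad] at hadd
  have h1 : lam ⬝ᵥ (b - b₀) ≤ ∑ j, lam j * (|b₀ j + (b - b₀) j| - |b₀ j|) := by
    refine Finset.sum_le_sum fun j _ => mul_le_mul_of_nonneg_left ?_ (hlam j)
    rw [abs_of_nonneg (hpos j)]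
    have := le_abs_self (b j)
    simpa using this
  have h2 : ∑ i, X.mulVec (b - b₀) i ^ 2 ≤ 0 := by linarith
  have h3 : X.mulVec (b - b₀) = X.mulVec 0 := by
    rw [Matrix.mulVec_zero]
    funext i
    have h4 := (Finset.sum_eq_zero_iff_of_nonneg fun i _ => sq_nonneg (X.mulVec (b - b₀) i)).1
      (le_antisymm h2 (Finset.sum_nonneg fun i _ => sq_nonneg _)) i (Finset.mem_univ i)
    simpa using h4
  exact sub_eq_zero.1 (hX h3)

theorem exists_measure_coord_le_neg_lt {Ω : Type*} [MeasurableSpace Ω] (P : Measure Ω)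
    [IsFiniteMeasure P] {p : ℕ} {u : Ω → Fin p → ℝ} (hu : Measurable u) {δ : ℝ≥0∞}
    (hδ : 0 < δ) : ∃ k : ℕ, P {ω | ∃ j, u ω j ≤ -(k : ℝ)} < δ := by
  have hmeas : ∀ k : ℕ, MeasurableSet {ω | ∃ j, u ω j ≤ -(k : ℝ)} := by
    intro k
    rw [Set.ofPred_exists]
    exact MeasurableSet.iUnion fun j =>
      measurableSet_le ((measurable_pi_apply j).comp hu) measurable_const
  have hanti : Antitone fun k : ℕ => {ω | ∃ j, u ω j ≤ -(k : ℝ)} := by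
    rintro k l hkl ω ⟨j, hj⟩
    have : (k : ℝ) ≤ l := by exact_mod_cast hkl
    exact ⟨j, by linarith⟩
  have hempty : ⋂ k : ℕ, {ω | ∃ j, u ω j ≤ -(k : ℝ)} = ∅ := by
    refine Set.eq_empty_iff_forall_notMem.2 fun ω hω => ?_
    obtain ⟨k, hk⟩ := exists_nat_gt (∑ j, |u ω j|)
    obtain ⟨j, hj⟩ := Set.mem_iInter.1 hω k
    have h1 := Finset.single_le_sum (fun i _ => abs_nonneg (u ω i)) (Finset.mem_univ j)
    have h2 := neg_abs_le (u ω j)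
    linarith
  have hlim := tendsto_measure_iInter_atTop (μ := P) (fun k => (hmeas k).nullMeasurableSet)
    hanti ⟨0, measure_ne_top _ _⟩
  rw [hempty, measure_empty] at hlim
  exact (hlim.eventually_lt_const hδ).exists

/-- **Minimal coverage over the non-negative orthant.** If `M` is Borel measurable,
non-random, and satisfies `⋂_j (A^1_{C_n,j}(m) ∪ B^1_{C_n,j}(m)) ⊆ M` for all `m ∈ M`
with `C_n = X'X/n`, then the infimum over `β` with `β_j ≥ 0` for all `j` of
`P_β(√n(β̂_L − β) ∈ M)` equals `P(û_n^ι ∈ M)` where `û_n^ι = C_n⁻¹(W_n − n^{−1/2}λ)`. -/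
theorem lasso_min_coverage_orthant
    {Ω : Type*} [MeasurableSpace Ω] (P : Measure Ω) [IsProbabilityMeasure P]
    (n p : ℕ) (hn : 0 < n) (hp : 0 < p) (hpn : p ≤ n)
    (X : Matrix (Fin n) (Fin p) ℝ) (hX : X.rank = p)
    (σ2 : ℝ≥0) (hσ : 0 < σ2)
    (ε : Ω → Fin n → ℝ) (hεmeas : Measurable ε)
    (hεdist : Measure.map ε P = Measure.pi fun _ : Fin n => gaussianReal 0 σ2)
    (lam : Fin p → ℝ) (hlam : ∀ j, 0 ≤ lam j)
    (βL : (Fin p → ℝ) → Ω → Fin p → ℝ)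
    (hβLmeas : ∀ β, Measurable (βL β))
    (hβL : ∀ β ω b, lassoObjective (X.mulVec β + ε ω) X lam (βL β ω)
      ≤ lassoObjective (X.mulVec β + ε ω) X lam b)
    (M : Set (Fin p → ℝ)) (hM : MeasurableSet M)
    (hMcond : ∀ m ∈ M,
      (⋂ j, (Asetj ((n : ℝ)⁻¹ • (Xᵀ * X)) 1 j m ∪ Bsetj ((n : ℝ)⁻¹ • (Xᵀ * X)) 1 j m)) ⊆ M)
    -- `û_n^ι = C_n⁻¹ (W_n − n^{−1/2} λ)` with `W_n = X'ε/√n`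
    (uhatι : Ω → Fin p → ℝ)
    (huhatι : ∀ ω, uhatι ω = ((n : ℝ)⁻¹ • (Xᵀ * X))⁻¹.mulVec
      ((Real.sqrt n)⁻¹ • Xᵀ.mulVec (ε ω) - (Real.sqrt n)⁻¹ • lam)) :
    (⨅ (β : Fin p → ℝ) (_ : ∀ j, 0 ≤ β j),
        P {ω | (fun j => Real.sqrt n * (βL β ω j - β j)) ∈ M}) = P {ω | uhatι ω ∈ M} := by
  have hs : 0 < Real.sqrt n := Real.sqrt_pos.2 (by exact_mod_cast hn)
  have hinj : Function.Injective X.mulVec := by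
    rw [Matrix.mulVec_injective_iff, linearIndependent_iff_card_eq_finrank_span,
      Set.finrank, ← Matrix.rank_eq_finrank_span_cols, hX, Fintype.card_fin]
  set C : Matrix (Fin p) (Fin p) ℝ := (n : ℝ)⁻¹ • (Xᵀ * X) with hC
  have hCunit : IsUnit C := by
    rw [← Matrix.mulVec_injective_iff_isUnit]
    intro v w hvw
    simp only [hC, Matrix.smul_mulVec] at hvw
    have h1 := smul_right_injective (Fin p → ℝ)
      (inv_ne_zero (by positivity : (n : ℝ) ≠ 0)) hvw
    have h2 : (Xᵀ * X).mulVec (v - w) = 0 := by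
      rw [Matrix.mulVec_sub, sub_eq_zero]
      exact h1
    rw [← Matrix.conjTranspose_eq_transpose_of_trivial] at h2
    have h3 : X.mulVec (v - w) = 0 := (Matrix.conjTranspose_mul_self_mulVec_eq_zero X _).1 h2
    exact sub_eq_zero.1 (hinj (h3.trans (Matrix.mulVec_zero X).symm))
  have hCmul : ∀ v, C.mulVec v = (n : ℝ)⁻¹ • Xᵀ.mulVec (X.mulVec v) := fun v => by
    rw [hC, Matrix.smul_mulVec, Matrix.mulVec_mulVec]
  have hCι : ∀ ω, C.mulVec (uhatι ω) =
      (Real.sqrt n)⁻¹ • Xᵀ.mulVec (ε ω) - (Real.sqrt n)⁻¹ • lam := fun ω => by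
    rw [huhatι, Matrix.mulVec_mulVec,
      Matrix.mul_nonsing_inv _ ((Matrix.isUnit_iff_isUnit_det _).1 hCunit), Matrix.one_mulVec]
  have hinv : (n : ℝ)⁻¹ * Real.sqrt n = (Real.sqrt n)⁻¹ := by
    rw [inv_mul_eq_iff_eq_mul₀ (by positivity), eq_mul_inv_iff_mul_eq₀ hs.ne',
      Real.mul_self_sqrt n.cast_nonneg]
  have hres : ∀ β b ω, Xᵀ.mulVec (X.mulVec β + ε ω - X.mulVec b) =
      Xᵀ.mulVec (ε ω) - Xᵀ.mulVec (X.mulVec (b - β)) := fun β b ω => by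
    rw [← Matrix.mulVec_sub, Matrix.mulVec_sub X]
    congr 1
    abel
  have hsub : ∀ β : Fin p → ℝ, (∀ j, 0 ≤ β j) →
      {ω | uhatι ω ∈ M} ⊆ {ω | (fun j => Real.sqrt n * (βL β ω j - β j)) ∈ M} := by
    intro β hβ ω hω
    refine hMcond _ hω (Set.mem_iInter.2 fun j => ?_)
    have hu : C.mulVec (fun j => Real.sqrt n * (βL β ω j - β j)) =
        (Real.sqrt n)⁻¹ • (Xᵀ.mulVec (ε ω)
          - Xᵀ.mulVec (X.mulVec β + ε ω - X.mulVec (βL β ω))) := by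
      have : (fun j => Real.sqrt n * (βL β ω j - β j)) = Real.sqrt n • (βL β ω - β) := rfl
      rw [this, hCmul, Matrix.mulVec_smul, Matrix.mulVec_smul, smul_smul, hinv, hres,
        sub_sub_cancel]
    have huj := congrFun hu j
    have hιj := congrFun (hCι ω) j
    simp only [Pi.smul_apply, Pi.sub_apply, smul_eq_mul] at huj hιj
    have hle := lasso_gradient_le hlam (hβL β ω) j
    rcases le_or_gt (Real.sqrt n * (βL β ω j - β j)) 0 with h | h
    · left
      refine ⟨?_, by simpa using h⟩
      rw [one_mul, one_mul, huj, hιj, ← mul_sub]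
      gcongr
    · right
      have hpos : 0 < βL β ω j := by
        have := pos_of_mul_pos_right h hs.le
        linarith [hβ j]
      refine ⟨?_, by simpa using h⟩
      rw [huj, hιj, lasso_gradient_eq_of_pos hlam (hβL β ω) hpos, mul_sub]
  have hιmeas : Measurable uhatι := by
    have : uhatι = fun ω => C⁻¹.mulVec
      ((Real.sqrt n)⁻¹ • Xᵀ.mulVec (ε ω) - (Real.sqrt n)⁻¹ • lam) := funext huhatι
    rw [this]
    have hcont : Continuous fun e : Fin n → ℝ => C⁻¹.mulVec
      ((Real.sqrt n)⁻¹ • Xᵀ.mulVec e - (Real.sqrt n)⁻¹ • lam) := by fun_prop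
    exact hcont.measurable.comp hεmeas
  refine le_antisymm ?_ (le_iInf₂ fun β hβ => measure_mono (hsub β hβ))
  refine ENNReal.le_of_forall_pos_le_add fun δ hδ _ => ?_
  obtain ⟨k, hk⟩ := exists_measure_coord_le_neg_lt P hιmeas (ENNReal.coe_pos.2 hδ)
  refine (iInf₂_le (fun _ => (Real.sqrt n)⁻¹ * (k : ℝ)) fun _ => by positivity).trans ?_
  refine (measure_mono ?_).trans ((measure_union_le _ _).trans (add_le_add le_rfl hk.le))
  intro ω hω
  by_cases hlow : ∃ j, uhatι ω j ≤ -(k : ℝ)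
  · exact Or.inr hlow
  left
  push Not at hlow
  set β : Fin p → ℝ := fun _ => (Real.sqrt n)⁻¹ * (k : ℝ) with hβdef
  have hb : βL β ω = β + (Real.sqrt n)⁻¹ • uhatι ω := by
    refine lasso_eq_of_gradient_eq hinj hlam (hβL β ω) (fun j => ?_) ?_
    · have h1 : 0 ≤ (Real.sqrt n)⁻¹ * (k + uhatι ω j) :=
        mul_nonneg (inv_nonneg.2 hs.le) (by linarith [hlow j])
      simpa [hβdef, mul_add] using h1
    · have h1 := congrArg (Real.sqrt n • ·) (hCι ω)
      simp only [hCmul, ← smul_sub, smul_smul, mul_inv_cancel₀ hs.ne', one_smul] at h1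
      rw [mul_comm, hinv] at h1
      rw [hres, add_sub_cancel_left, Matrix.mulVec_smul, Matrix.mulVec_smul, h1, sub_sub_cancel]
  have hu : (fun j => Real.sqrt n * (βL β ω j - β j)) = uhatι ω := by
    funext j
    rw [hb]
    simp [hs.ne']
  exact (congrArg (· ∈ M) hu).mp hω
end
end

section
/- Let C be a symmetric positive definite p×p matrix, λ ∈ [0,∞)^p, σ² > 0, and W ~ N(0, σ² C). For t ∈ [−∞,∞]^p let û(t) be the unique minimizer over u ∈ ℝ^p of Q_t(u) = u'Cu − 2W'u + 2 Σ_{j=1}^p λ_j [ 1{t_j ∈ ℝ}(|t_j + u_j| − |t_j|) + 1{|t_j| = ∞} sgn(t_j) u_j ], and let û^ι be the unique minimizer of u'Cu − 2W'u + 2 Σ_{j=1}^p λ_j u_j. If M ⊆ ℝ^p is Borel measurable and satisfies ⋂_{j=1}^p (A^{1}_{C,j}(m) ∪ B^{1}_{C,j}(m)) ⊆ M for all m ∈ M, then inf over all t ∈ [−∞,∞]^p with t_j ≥ 0 for all j of P(û(t) ∈ M) equals P(û^ι ∈ M). -/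
open MeasureTheory ProbabilityTheory Filter Matrix Set
open scoped ENNReal NNReal BigOperators

noncomputable section

/-- `Q^ι(u) = u'Cu − 2W'u + 2 Σ_j λ_j u_j`. -/
def Qιfun {p : ℕ} (C : Matrix (Fin p) (Fin p) ℝ) (W lam : Fin p → ℝ) (u : Fin p → ℝ) : ℝ :=
  u ⬝ᵥ C.mulVec u - 2 * (W ⬝ᵥ u) + 2 * ∑ j, lam j * u j

/-- Expansion of the quadratic objective with separable penalty along a coordinate direction. -/
lemma separable_objective_add_single {p : ℕ} {C : Matrix (Fin p) (Fin p) ℝ} (hC : Cᵀ = C)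
    (W : Fin p → ℝ) (f : Fin p → ℝ → ℝ) (u : Fin p → ℝ) (j : Fin p) (h : ℝ) :
    (u + Pi.single j h) ⬝ᵥ C.mulVec (u + Pi.single j h) - 2 * (W ⬝ᵥ (u + Pi.single j h))
        + 2 * ∑ i, f i ((u + Pi.single j h : Fin p → ℝ) i) =
      (u ⬝ᵥ C.mulVec u - 2 * (W ⬝ᵥ u) + 2 * ∑ i, f i (u i))
        + (2 * h * (C.mulVec u j - W j) + h ^ 2 * C j j + 2 * (f j (u j + h) - f j (u j))) := by
  have hsum : ∑ i, f i ((u + Pi.single j h : Fin p → ℝ) i) - ∑ i, f i (u i) =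
      f j (u j + h) - f j (u j) := by
    rw [← Finset.sum_sub_distrib, Finset.sum_eq_single j]
    · simp
    · intro i _ hi
      simp [Pi.single_eq_of_ne hi]
    · simp
  have hsymm : u ⬝ᵥ C.mulVec (Pi.single j h) = h * C.mulVec u j := by
    rw [dotProduct_mulVec, ← mulVec_transpose, hC, dotProduct_single, mul_comm]
  have hdiag : C.mulVec (Pi.single j h) j = h * C j j := by
    simp [mulVec_single, mul_comm]
  rw [mulVec_add, dotProduct_add, add_dotProduct, add_dotProduct, dotProduct_add, hsymm,
    single_dotProduct, single_dotProduct, hdiag, dotProduct_single]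
  linear_combination 2 * hsum

/-- One-sided first-order condition at a minimizer: if the `j`-th penalty grows at most linearly
with slope `l` in the direction of the sign `s`, then `s * ((C u)_j - W_j + l) ≥ 0`. -/
lemma separable_objective_first_order {p : ℕ} {C : Matrix (Fin p) (Fin p) ℝ} (hC : Cᵀ = C)
    {W : Fin p → ℝ} {f : Fin p → ℝ → ℝ} {u : Fin p → ℝ}
    (hu : ∀ v : Fin p → ℝ, u ⬝ᵥ C.mulVec u - 2 * (W ⬝ᵥ u) + 2 * ∑ i, f i (u i) ≤
      v ⬝ᵥ C.mulVec v - 2 * (W ⬝ᵥ v) + 2 * ∑ i, f i (v i))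
    (j : Fin p) (s l : ℝ)
    (hf : ∀ᶠ h in nhdsWithin (0 : ℝ) (Ioi 0), f j (u j + s * h) ≤ f j (u j) + l * (s * h)) :
    0 ≤ s * (C.mulVec u j - W j + l) := by
  have hlim : Tendsto (fun h : ℝ => 2 * (s * (C.mulVec u j - W j + l)) + h * (s ^ 2 * C j j))
      (nhdsWithin 0 (Ioi 0)) (nhds (2 * (s * (C.mulVec u j - W j + l)))) := by
    have hcont : Continuous
        (fun h : ℝ => 2 * (s * (C.mulVec u j - W j + l)) + h * (s ^ 2 * C j j)) := by fun_prop
    simpa using (hcont.tendsto 0).mono_left nhdsWithin_le_nhds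
  have hnonneg : 0 ≤ 2 * (s * (C.mulVec u j - W j + l)) := by
    refine ge_of_tendsto hlim ?_
    filter_upwards [hf, self_mem_nhdsWithin] with h hfh hpos
    have hpos : 0 < h := hpos
    have hmin := hu (u + Pi.single j (s * h))
    rw [separable_objective_add_single hC] at hmin
    refine nonneg_of_mul_nonneg_right (a := h) ?_ hpos
    nlinarith
  linarith

lemma penTerm_add_le {t : EReal} (ht : 0 ≤ t) {l : ℝ} (hl : 0 ≤ l) (x : ℝ) {h : ℝ} (hh : 0 ≤ h) :
    penTerm t l (x + h) ≤ penTerm t l x + l * h := by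
  have hbot : t ≠ ⊥ := fun hb => by simp [hb] at ht
  unfold penTerm
  split_ifs
  · linarith
  · have habs : |t.toReal + (x + h)| ≤ |t.toReal + x| + h := by
      rw [← add_assoc]
      exact (abs_add_le _ _).trans_eq (by rw [abs_of_nonneg hh])
    nlinarith

lemma penTerm_of_nonneg {t : EReal} (ht : 0 ≤ t) (l : ℝ) {x : ℝ} (hx : 0 ≤ x) :
    penTerm t l x = l * x := by
  have hbot : t ≠ ⊥ := fun hb => by simp [hb] at ht
  have htr : 0 ≤ t.toReal := EReal.toReal_nonneg ht
  unfold penTerm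
  split_ifs
  · rfl
  · rw [abs_of_nonneg htr, abs_of_nonneg (add_nonneg htr hx)]
    ring

lemma le_mulVec_of_isMin_Qfun {p : ℕ} {C : Matrix (Fin p) (Fin p) ℝ} (hC : Cᵀ = C)
    {W lam : Fin p → ℝ} (hlam : ∀ j, 0 ≤ lam j) {t : Fin p → EReal} (ht : ∀ j, 0 ≤ t j)
    {u : Fin p → ℝ} (hu : ∀ v, Qfun C W lam t u ≤ Qfun C W lam t v) (j : Fin p) :
    W j - lam j ≤ C.mulVec u j := by
  have hfo := separable_objective_first_order (f := fun i => penTerm (t i) (lam i)) hC hu j 1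
    (lam j) (by
      filter_upwards [self_mem_nhdsWithin] with h hpos
      simpa using penTerm_add_le (ht j) (hlam j) (u j) (le_of_lt hpos))
  linarith

lemma mulVec_eq_of_isMin_Qfun_of_pos {p : ℕ} {C : Matrix (Fin p) (Fin p) ℝ} (hC : Cᵀ = C)
    {W lam : Fin p → ℝ} (hlam : ∀ j, 0 ≤ lam j) {t : Fin p → EReal} (ht : ∀ j, 0 ≤ t j)
    {u : Fin p → ℝ} (hu : ∀ v, Qfun C W lam t u ≤ Qfun C W lam t v) {j : Fin p} (hj : 0 < u j) :
    C.mulVec u j = W j - lam j := by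
  have hfo := separable_objective_first_order (f := fun i => penTerm (t i) (lam i)) hC hu j (-1)
    (lam j) (by
      filter_upwards [mem_nhdsWithin_of_mem_nhds (Iio_mem_nhds hj)] with h hlt
      have hlt : h < u j := hlt
      rw [penTerm_of_nonneg (ht j) _ hj.le, penTerm_of_nonneg (ht j) _ (by linarith)]
      linarith)
  linarith [le_mulVec_of_isMin_Qfun hC hlam ht hu j]

lemma mulVec_eq_of_isMin_Qιfun {p : ℕ} {C : Matrix (Fin p) (Fin p) ℝ} (hC : Cᵀ = C)
    {W lam u : Fin p → ℝ} (hu : ∀ v, Qιfun C W lam u ≤ Qιfun C W lam v) (j : Fin p) :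
    C.mulVec u j = W j - lam j := by
  have hfo (s : ℝ) := separable_objective_first_order (f := fun i x => lam i * x) hC hu j s
    (lam j) (.of_forall fun h => by linarith)
  linarith [hfo 1, hfo (-1)]

lemma Qfun_top {p : ℕ} (C : Matrix (Fin p) (Fin p) ℝ) (W lam u : Fin p → ℝ) :
    Qfun C W lam (fun _ => ⊤) u = Qιfun C W lam u := by
  simp [Qfun, Qιfun, penTerm]

lemma mem_iInter_Asetj_union_Bsetj {p : ℕ} {C : Matrix (Fin p) (Fin p) ℝ} {m z : Fin p → ℝ}
    (hle : ∀ j, C.mulVec m j ≤ C.mulVec z j)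
    (heq : ∀ j, 0 < z j → C.mulVec z j = C.mulVec m j) :
    z ∈ ⋂ j, (Asetj C 1 j m ∪ Bsetj C 1 j m) := by
  refine mem_iInter.2 fun j => ?_
  rcases le_or_gt (z j) 0 with hz | hz
  · exact Or.inl ⟨by simpa using hle j, by simpa using hz⟩
  · exact Or.inr ⟨heq j hz, by simpa using hz⟩

/-- **Asymptotic minimal coverage over the non-negative orthant (conservative tuning).**
If `M` is Borel measurable and satisfies `⋂_j (A^1_{C,j}(m) ∪ B^1_{C,j}(m)) ⊆ M` for all
`m ∈ M`, then `inf {P(û(t) ∈ M) : t ∈ [−∞,∞]^p, t_j ≥ 0 ∀j} = P(û^ι ∈ M)`. -/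
theorem asymptotic_min_coverage_orthant
    {Ω : Type*} [MeasurableSpace Ω] (P : Measure Ω) [IsProbabilityMeasure P]
    {p : ℕ} (hp : 0 < p)
    (C : Matrix (Fin p) (Fin p) ℝ) (hC : C.PosDef)
    (lam : Fin p → ℝ) (hlam : ∀ j, 0 ≤ lam j)
    (σ2 : ℝ) (hσ : 0 < σ2)
    (W : Ω → Fin p → ℝ) (hWmeas : Measurable W)
    (hW : IsMvGaussian (Measure.map W P) 0 (σ2 • C))
    (uhat : (Fin p → EReal) → Ω → Fin p → ℝ)
    (huhatmeas : ∀ t, Measurable (uhat t))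
    (huhat : ∀ t ω u, Qfun C (W ω) lam t (uhat t ω) ≤ Qfun C (W ω) lam t u)
    (uhatι : Ω → Fin p → ℝ) (huhatιmeas : Measurable uhatι)
    (huhatι : ∀ ω u, Qιfun C (W ω) lam (uhatι ω) ≤ Qιfun C (W ω) lam u)
    (M : Set (Fin p → ℝ)) (hM : MeasurableSet M)
    (hMcond : ∀ m ∈ M, (⋂ j, (Asetj C 1 j m ∪ Bsetj C 1 j m)) ⊆ M) :
    (⨅ (t : Fin p → EReal) (_ : ∀ j, (0 : EReal) ≤ t j), P {ω | uhat t ω ∈ M}) =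
      P {ω | uhatι ω ∈ M} := by
  have hsymm : Cᵀ = C := by
    have h := hC.isHermitian
    rwa [IsHermitian, conjTranspose_eq_transpose_of_trivial] at h
  have hι (ω j) := mulVec_eq_of_isMin_Qιfun hsymm (huhatι ω) j
  apply le_antisymm
  · refine (iInf₂_le (fun _ => ⊤) fun _ => le_top).trans (measure_mono fun ω hω => ?_)
    have htop (j) : C.mulVec (uhat (fun _ => ⊤) ω) j = W ω j - lam j :=
      mulVec_eq_of_isMin_Qιfun hsymm
        (fun v => by simpa only [Qfun_top] using huhat (fun _ => ⊤) ω v) j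
    exact hMcond _ hω (mem_iInter_Asetj_union_Bsetj (fun j => by rw [hι, htop])
      fun j _ => by rw [hι, htop])
  · refine le_iInf₂ fun t ht => measure_mono fun ω hω => ?_
    refine hMcond _ hω (mem_iInter_Asetj_union_Bsetj (fun j => ?_) fun j hj => ?_)
    · rw [hι]
      exact le_mulVec_of_isMin_Qfun hsymm hlam ht (huhat t ω) j
    · rw [hι]
      exact mulVec_eq_of_isMin_Qfun_of_pos hsymm hlam ht (huhat t ω) hj
end
end

section
/- Let C be a symmetric positive definite p×p matrix, W ∈ ℝ^p, λ ∈ [0,∞)^p and b ∈ ℝ^p with b_j ≥ 0 for all j. Let û be the unique minimizer over u ∈ ℝ^p of f(u) = u'Cu − 2u'W + 2 Σ_{j=1}^p λ_j (|u_j + b_j| − |b_j|), and let û^ι = C^{−1}(W − λ). Then (C û^ι)_j ≤ (C û)_j for all j = 1,…,p. -/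
open MeasureTheory ProbabilityTheory Filter Matrix Set
open scoped ENNReal NNReal BigOperators

noncomputable section

/-- The objective function `f(u) = u'Cu − 2u'W + 2 Σ_j λ_j (|u_j + b_j| − |b_j|)`. -/
def objF {p : ℕ} (C : Matrix (Fin p) (Fin p) ℝ) (W lam b : Fin p → ℝ) (u : Fin p → ℝ) : ℝ :=
  u ⬝ᵥ C.mulVec u - 2 * (u ⬝ᵥ W) + 2 * ∑ j, lam j * (|u j + b j| - |b j|)

/-- Moving the `j`-th coordinate up by `t ≥ 0` changes `objF` by at most a quadratic in `t`. -/
lemma objF_add_single_le {p : ℕ} {C : Matrix (Fin p) (Fin p) ℝ} (hC : C.IsSymm)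
    (W b u : Fin p → ℝ) {lam : Fin p → ℝ} (j : Fin p) (hlam : 0 ≤ lam j) {t : ℝ} (ht : 0 ≤ t) :
    objF C W lam b (u + Pi.single j t) ≤
      objF C W lam b u + 2 * t * (C.mulVec u j - W j + lam j) + t ^ 2 * C j j := by
  have h_cross : u ⬝ᵥ C.mulVec (Pi.single j t) = t * C.mulVec u j := by
    rw [dotProduct_mulVec, ← mulVec_transpose, hC.eq, dotProduct_single, mul_comm]
  have h_diag : Pi.single j t ⬝ᵥ C.mulVec (Pi.single j t) = t ^ 2 * C j j := by
    simp only [single_dotProduct, mulVec, dotProduct_single]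
    ring
  have h_sum : ∑ i, lam i * (|(u + Pi.single j t : Fin p → ℝ) i + b i| - |b i|) ≤
      ∑ i, lam i * (|u i + b i| - |b i|) + t * lam j := by
    have h_single : t * lam j = ∑ i, (Pi.single j (t * lam j) : Fin p → ℝ) i := by simp
    rw [h_single, ← Finset.sum_add_distrib]
    refine Finset.sum_le_sum fun i _ => ?_
    obtain rfl | hij := eq_or_ne i j
    · have h_abs : |u i + t + b i| ≤ |u i + b i| + t := by
        calc |u i + t + b i| = |u i + b i + t| := by ring_nf
          _ ≤ |u i + b i| + |t| := abs_add_le _ _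
          _ = |u i + b i| + t := by rw [abs_of_nonneg ht]
      simp only [Pi.add_apply, Pi.single_eq_same]
      nlinarith [mul_le_mul_of_nonneg_left h_abs hlam]
    · simp [Pi.single_eq_of_ne hij]
  simp only [objF, mulVec_add, add_dotProduct, dotProduct_add, h_cross, h_diag]
  rw [single_dotProduct, single_dotProduct]
  linarith

/-- If `û` minimizes `f` and `û^ι = C⁻¹(W − λ)`, and all `b_j ≥ 0`, then
`(C û^ι)_j ≤ (C û)_j` for all `j`. -/
theorem mulVec_min_le {p : ℕ} (C : Matrix (Fin p) (Fin p) ℝ) (hC : C.PosDef)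
    (W lam b : Fin p → ℝ) (hlam : ∀ j, 0 ≤ lam j) (hb : ∀ j, 0 ≤ b j)
    (uhat : Fin p → ℝ) (hmin : ∀ u : Fin p → ℝ, objF C W lam b uhat ≤ objF C W lam b u)
    (j : Fin p) :
    C.mulVec (C⁻¹.mulVec (W - lam)) j ≤ C.mulVec uhat j := by
  have h_symm : C.IsSymm := by simpa using hC.isHermitian
  have h_diag : 0 < C j j := hC.diag_pos
  rw [mulVec_mulVec, mul_nonsing_inv C hC.det_pos.ne'.isUnit, one_mulVec, Pi.sub_apply]
  by_contra! h
  set a := C.mulVec uhat j - W j + lam j with ha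
  have h_neg : a < 0 := by linarith
  have ht : 0 < -a / C j j := div_pos (neg_pos.mpr h_neg) h_diag
  have h_le := (hmin _).trans (objF_add_single_le h_symm W b uhat j (hlam j) ht.le)
  have h_eq : (-a / C j j) * C j j = -a := div_mul_cancel₀ _ h_diag.ne'
  nlinarith [mul_pos ht (neg_pos.mpr h_neg)]
end
end

section
/- Let C be a symmetric positive definite p×p matrix, W ∈ ℝ^p, λ ∈ [0,∞)^p and b ∈ ℝ^p with b_j ≥ 0 for all j. Let û be the unique minimizer over u ∈ ℝ^p of f(u) = u'Cu − 2u'W + 2 Σ_{j=1}^p λ_j (|u_j + b_j| − |b_j|), and let û^ι = C^{−1}(W − λ). Then for any j = 1,…,p, if û_j > 0 then (C û)_j = (C û^ι)_j. -/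
open MeasureTheory ProbabilityTheory Filter Matrix Set
open scoped ENNReal NNReal BigOperators

noncomputable section

/-- Change of the objective along a coordinate direction that keeps that coordinate
nonnegative. -/
lemma objF_add_single {p : ℕ} {C : Matrix (Fin p) (Fin p) ℝ} (hC : C.IsSymm)
    {W lam b u : Fin p → ℝ} {j : Fin p} {t : ℝ} (hu : 0 ≤ u j + b j)
    (hut : 0 ≤ u j + t + b j) :
    objF C W lam b (u + Pi.single j t) =
      objF C W lam b u + (2 * t * (C.mulVec u j - W j + lam j) + t ^ 2 * C j j) := by
  have hsum : ∑ i, lam i * (|(u + Pi.single j t : Fin p → ℝ) i + b i| - |b i|) =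
      ∑ i, lam i * (|u i + b i| - |b i|) + lam j * t := by
    rw [← sub_eq_iff_eq_add', ← Finset.sum_sub_distrib, Finset.sum_eq_single j]
    · simp only [Pi.add_apply, Pi.single_eq_same]
      rw [abs_of_nonneg hu, abs_of_nonneg hut]
      ring
    · intro i _ hij
      simp [Pi.single_eq_of_ne hij]
    · simp
  have hcross : u ⬝ᵥ C.mulVec (Pi.single j t) = t * C.mulVec u j := by
    rw [dotProduct_mulVec, ← mulVec_transpose, hC.eq, dotProduct_single, mul_comm]
  have hdiag : C.mulVec (Pi.single j t) j = C j j * t := by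
    simp [mulVec, dotProduct_single]
  unfold objF
  rw [hsum, mulVec_add, add_dotProduct, add_dotProduct, dotProduct_add, dotProduct_add, hcross]
  simp only [single_dotProduct, hdiag]
  ring

/-- A quadratic without constant term that is nonnegative near zero has no linear term. -/
lemma eq_zero_of_forall_abs_le_quadratic_nonneg {a c r : ℝ} (hr : 0 < r)
    (h : ∀ t : ℝ, |t| ≤ r → 0 ≤ 2 * t * a + t ^ 2 * c) : a = 0 := by
  have hlocal : IsLocalMin (fun t : ℝ => 2 * t * a + t ^ 2 * c) 0 := by
    filter_upwards [Metric.closedBall_mem_nhds (0 : ℝ) hr] with t ht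
    simpa using h t (by simpa using ht)
  have hderiv : HasDerivAt (fun t : ℝ => 2 * t * a + t ^ 2 * c) (2 * a) 0 :=
    ((((hasDerivAt_id' (0 : ℝ)).const_mul 2).mul_const a).fun_add
      ((hasDerivAt_pow 2 (0 : ℝ)).mul_const c)).congr_deriv (by simp)
  linarith [hlocal.hasDerivAt_eq_zero hderiv]

/-- If `û` minimizes `f`, `û^ι = C⁻¹(W − λ)`, all `b_j ≥ 0`, and `û_j > 0` for some `j`,
then `(C û)_j = (C û^ι)_j`. -/
theorem mulVec_eq_of_pos {p : ℕ} (C : Matrix (Fin p) (Fin p) ℝ) (hC : C.PosDef)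
    (W lam b : Fin p → ℝ) (hlam : ∀ j, 0 ≤ lam j) (hb : ∀ j, 0 ≤ b j)
    (uhat : Fin p → ℝ) (hmin : ∀ u : Fin p → ℝ, objF C W lam b uhat ≤ objF C W lam b u)
    (j : Fin p) (hj : 0 < uhat j) :
    C.mulVec uhat j = C.mulVec (C⁻¹.mulVec (W - lam)) j := by
  have hsymm : C.IsSymm := by
    simpa [IsHermitian, IsSymm, conjTranspose_eq_transpose_of_trivial] using hC.isHermitian
  have hslope : C.mulVec uhat j - W j + lam j = 0 := by
    refine eq_zero_of_forall_abs_le_quadratic_nonneg (c := C j j) hj fun t ht => ?_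
    have hle := hmin (uhat + Pi.single j t)
    rw [objF_add_single hsymm (by linarith [hb j])
      (by linarith [hb j, neg_le_of_abs_le ht])] at hle
    linarith
  rw [mulVec_mulVec, mul_nonsing_inv C ((isUnit_iff_isUnit_det C).mp hC.isUnit), one_mulVec,
    Pi.sub_apply]
  linarith
end
end

section
/- Let C be a symmetric positive definite p×p matrix, W ∈ ℝ^p, λ ∈ [0,∞)^p and b ∈ ℝ^p. Let û be the unique minimizer over u ∈ ℝ^p of f(u) = u'Cu − 2u'W + 2 Σ_{j=1}^p λ_j (|u_j + b_j| − |b_j|). If û_j + b_j > 0 for all j = 1,…,p, then û = C^{−1}(W − λ). -/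
open MeasureTheory ProbabilityTheory Filter Matrix Set
open scoped ENNReal NNReal BigOperators

noncomputable section

/-- On the region where every `u_j + b_j` is nonnegative, the objective is quadratic. -/
theorem objF_add_smul_of_nonneg {p : ℕ} {C : Matrix (Fin p) (Fin p) ℝ} (hC : C.IsSymm)
    (W lam b u d : Fin p → ℝ) (t : ℝ) (hu : ∀ j, 0 ≤ u j + b j)
    (hut : ∀ j, 0 ≤ (u + t • d) j + b j) :
    objF C W lam b (u + t • d) = objF C W lam b u
      + (2 * (d ⬝ᵥ (C *ᵥ u - W + lam)) * t + (d ⬝ᵥ C *ᵥ d) * t ^ 2) := by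
  have hsymm : u ⬝ᵥ C *ᵥ d = d ⬝ᵥ C *ᵥ u := by
    rw [dotProduct_mulVec, ← mulVec_transpose, hC.eq, dotProduct_comm]
  have hsum : ∑ j, lam j * (|(u + t • d) j + b j| - |b j|)
      = ∑ j, lam j * (|u j + b j| - |b j|) + t * (d ⬝ᵥ lam) := by
    rw [dotProduct, Finset.mul_sum, ← Finset.sum_add_distrib]
    refine Finset.sum_congr rfl fun j _ => ?_
    rw [abs_of_nonneg (hut j), abs_of_nonneg (hu j)]
    simp only [Pi.add_apply, Pi.smul_apply, smul_eq_mul]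
    ring
  rw [objF, objF, hsum]
  simp only [mulVec_add, mulVec_smul, add_dotProduct, dotProduct_add, dotProduct_sub,
    smul_dotProduct, dotProduct_smul, smul_eq_mul, hsymm]
  ring

/-- If `û` minimizes `f` and `û_j + b_j > 0` for all `j`, then `û = C⁻¹(W − λ)`. -/
theorem minimizer_eq_of_pos {p : ℕ} (C : Matrix (Fin p) (Fin p) ℝ) (hC : C.PosDef)
    (W lam b : Fin p → ℝ) (hlam : ∀ j, 0 ≤ lam j)
    (uhat : Fin p → ℝ) (hmin : ∀ u : Fin p → ℝ, objF C W lam b uhat ≤ objF C W lam b u)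
    (hpos : ∀ j, 0 < uhat j + b j) :
    uhat = C⁻¹.mulVec (W - lam) := by
  have hsymm : C.IsSymm := by
    simpa [IsHermitian, IsSymm, conjTranspose_eq_transpose_of_trivial] using hC.isHermitian
  set g := C *ᵥ uhat - W + lam with hg
  have hev : ∀ᶠ t : ℝ in nhds 0, ∀ j, 0 < (uhat + t • g) j + b j := by
    refine Filter.eventually_all.2 fun j => ?_
    have hc : Continuous fun t : ℝ => (uhat + t • g) j + b j := by
      simp only [Pi.add_apply, Pi.smul_apply, smul_eq_mul]
      fun_prop
    exact hc.continuousAt.eventually_const_lt (by simpa using hpos j)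
  have hloc : IsLocalMin (fun t : ℝ => 2 * (g ⬝ᵥ g) * t + (g ⬝ᵥ C *ᵥ g) * t ^ 2) 0 := by
    filter_upwards [hev] with t ht
    have h := hmin (uhat + t • g)
    rw [objF_add_smul_of_nonneg hsymm W lam b uhat g t (fun j => (hpos j).le)
      (fun j => (ht j).le), ← hg] at h
    simpa using h
  have hderiv : HasDerivAt (fun t : ℝ => 2 * (g ⬝ᵥ g) * t + (g ⬝ᵥ C *ᵥ g) * t ^ 2)
      (2 * (g ⬝ᵥ g)) 0 := by
    simpa using ((hasDerivAt_id (0 : ℝ)).const_mul (2 * (g ⬝ᵥ g))).fun_add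
      ((hasDerivAt_pow 2 (0 : ℝ)).const_mul (g ⬝ᵥ C *ᵥ g))
  have hg0 : g = 0 := by
    have h := hloc.hasDerivAt_eq_zero hderiv
    exact dotProduct_self_eq_zero.1 (by linarith)
  have hCu : C *ᵥ uhat = W - lam := by
    rw [← sub_eq_zero, ← hg0, hg]
    abel
  rw [← hCu, mulVec_mulVec, nonsing_inv_mul C ((isUnit_iff_isUnit_det C).1 hC.isUnit), one_mulVec]
end
end
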